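/- Let n ≥ 1 and let f : [0,∞) → ℝ be continuous with f(s) > 0 for all s > 0 and ∫₀¹ f(z)/z dz < ∞, and define f̃(s) = ∫₀^s f(z)/z dz for s ≥ 0. Assume: (A) either n = 1, or there exists p with 1 < p < n(n+2)/(n−1)² such that f(s) ≤ p·f̃(s) for all s > 0; and (B) there exist c > 0 and real numbers m₁, m₂ with 2/3 < m₂ < m₁ < 2(n+2)/(3n+2) such that f(s) ≥ c s^{m₁} f̃(s)^{2m₁−1} for all s ∈ (0,1] and f(s) ≥ c s^{m₂} f̃(s)^{2m₂−1} for all s > 1. Then the only nonnegative classical solution u : ℝⁿ × ℝ → ℝ of u_t − Δu = f(u) on ℝⁿ × ℝ (i.e. u, ∂_t u and the spatial partial derivatives of u up to order two exist and are continuous, and the equation holds pointwise) is u ≡ 0. -/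

import Mathlib

open Set Filter MeasureTheory

/-- A classical solution of `u_t - Δu = f(u)` on all of `ℝⁿ × ℝ`: `u`, `∂_t u`
and the (pure) spatial partial derivatives of `u` up to order two exist and are
continuous, and the equation holds pointwise. -/
def IsEntireParabolicSol {n : ℕ} (f : ℝ → ℝ)
    (u : (Fin n → ℝ) → ℝ → ℝ) : Prop :=
  Continuous (fun p : (Fin n → ℝ) × ℝ => u p.1 p.2) ∧
  (∀ (x : Fin n → ℝ) (t : ℝ), DifferentiableAt ℝ (u x) t) ∧
  Continuous (fun p : (Fin n → ℝ) × ℝ => deriv (u p.1) p.2) ∧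
  (∀ (x : Fin n → ℝ) (t : ℝ) (i : Fin n),
    DifferentiableAt ℝ (fun s : ℝ => u (Function.update x i s) t) (x i)) ∧
  (∀ i : Fin n, Continuous (fun p : (Fin n → ℝ) × ℝ =>
    deriv (fun s : ℝ => u (Function.update p.1 i s) p.2) (p.1 i))) ∧
  (∀ (x : Fin n → ℝ) (t : ℝ) (i : Fin n),
    DifferentiableAt ℝ (deriv (fun s : ℝ => u (Function.update x i s) t)) (x i)) ∧
  (∀ i : Fin n, Continuous (fun p : (Fin n → ℝ) × ℝ =>
    deriv (deriv (fun s : ℝ => u (Function.update p.1 i s) p.2)) (p.1 i))) ∧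
  (∀ (x : Fin n → ℝ) (t : ℝ),
    deriv (u x) t -
      ∑ i : Fin n, deriv (deriv (fun s : ℝ => u (Function.update x i s) t)) (x i)
      = f (u x t))

/-- `f̃(s) = ∫₀^s f(z)/z dz`. -/
noncomputable def fTilde (f : ℝ → ℝ) (s : ℝ) : ℝ :=
  ∫ z in Ioc (0 : ℝ) s, f z / z

section Helpers

/-- space-time -/
abbrev XT (n : ℕ) := (Fin n → ℝ) × ℝ

/-- `g` has directional derivative along `e` everywhere. -/
def LD {n : ℕ} (g g' : XT n → ℝ) (e : XT n) : Prop :=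
  ∀ z, HasDerivAt (fun s : ℝ => g (z + s • e)) (g' z) 0

theorem LD.mul {n : ℕ} {g g' k k' : XT n → ℝ} {e : XT n} (hg : LD g g' e) (hk : LD k k' e) :
    LD (fun z => g z * k z) (fun z => g' z * k z + g z * k' z) e := by
  intro z
  have := (hg z).mul (hk z)
  simp only [zero_smul, add_zero] at this
  exact this

theorem LD.add {n : ℕ} {g g' k k' : XT n → ℝ} {e : XT n} (hg : LD g g' e) (hk : LD k k' e) :
    LD (fun z => g z + k z) (fun z => g' z + k' z) e := by
  intro z
  exact (hg z).add (hk z)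

theorem LD.comp {n : ℕ} {g g' : XT n → ℝ} {e : XT n} (hg : LD g g' e) {G G' : ℝ → ℝ}
    (hG : ∀ z, HasDerivAt G (G' (g z)) (g z)) :
    LD (fun z => G (g z)) (fun z => G' (g z) * g' z) e := by
  intro z
  have h1 : HasDerivAt G (G' (g z)) ((fun s : ℝ => g (z + s • e)) 0) := by
    simpa using hG z
  exact h1.comp 0 (hg z)

theorem LD.congr {n : ℕ} {g g' k' : XT n → ℝ} {e : XT n} (hg : LD g g' e)
    (h : ∀ z, g' z = k' z) : LD g k' e := by
  intro z
  rw [← h z]; exact hg z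

theorem LD.of_diff {n : ℕ} {W : XT n → ℝ} (hW : Differentiable ℝ W) (e : XT n) :
    LD W (fun z => fderiv ℝ W z e) e := by
  intro z
  exact (hW z).hasFDerivAt.hasLineDerivAt e

theorem LD.zero_off {n : ℕ} {g g' : XT n → ℝ} {e : XT n} (hg : LD g g' e) {z : XT n}
    (hz : z ∉ tsupport g) : g' z = 0 := by
  have h1 : g =ᶠ[nhds z] 0 := notMem_tsupport_iff_eventuallyEq.1 hz
  have hc : Tendsto (fun s : ℝ => z + s • e) (nhds 0) (nhds z) := by
    have : Continuous (fun s : ℝ => z + s • e) := by fun_prop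
    simpa using this.tendsto 0
  have h2 : (fun s : ℝ => g (z + s • e)) =ᶠ[nhds 0] fun _ => 0 := hc.eventually h1
  have h3 := (hasDerivAt_const (0:ℝ) (0:ℝ)).congr_of_eventuallyEq h2
  exact (hg z).unique h3

theorem LD.compact {n : ℕ} {g g' : XT n → ℝ} {e : XT n} (hg : LD g g' e)
    (hc : HasCompactSupport g) : HasCompactSupport g' :=
  HasCompactSupport.intro hc (fun _ hz => hg.zero_off hz)

instance instHaarXT (n : ℕ) : (volume : Measure (XT n)).IsAddHaarMeasure := by
  rw [Measure.volume_eq_prod]; infer_instance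

def Null {n : ℕ} (g : XT n → ℝ) : Prop := Integrable g ∧ ∫ z, g z = 0

theorem LD.null {n : ℕ} {g g' : XT n → ℝ} {e : XT n} (hg : LD g g' e)
    (hc : HasCompactSupport g) (cg : Continuous g) (cg' : Continuous g') : Null g' := by
  have i1 : Integrable g' := cg'.integrable_of_hasCompactSupport (hg.compact hc)
  have i0 : Integrable g := cg.integrable_of_hasCompactSupport hc
  refine ⟨i1, ?_⟩
  have := integral_bilinear_hasLineDerivAt_right_eq_neg_left_of_integrable (μ := (volume : Measure (XT n)))
    (f := fun _ => (1:ℝ)) (f' := fun _ => (0:ℝ)) (g := g) (g' := g') (v := e)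
    (B := ContinuousLinearMap.mul ℝ ℝ) (by simp) (by simpa using i1) (by simpa using i0)
    (fun x _ => hasDerivAt_const _ _) (fun x _ => hg x)
  simpa using this

theorem Null.add {n : ℕ} {g k : XT n → ℝ} (hg : Null g) (hk : Null k) :
    Null (fun z => g z + k z) :=
  ⟨hg.1.add hk.1, by rw [integral_add hg.1 hk.1, hg.2, hk.2, add_zero]⟩

theorem Null.const_mul {n : ℕ} {g : XT n → ℝ} (hg : Null g) (c : ℝ) :
    Null (fun z => c * g z) :=
  ⟨hg.1.const_mul c, by rw [integral_const_mul, hg.2, mul_zero]⟩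

theorem Null.sum {n : ℕ} {ι : Type*} [Fintype ι] {g : ι → XT n → ℝ} (hg : ∀ i, Null (g i)) :
    Null (fun z => ∑ i, g i z) :=
  ⟨integrable_finsetSum _ (fun i _ => (hg i).1), by
    rw [integral_finsetSum _ (fun i _ => (hg i).1)]; simp [fun i => (hg i).2]⟩

theorem Null.congr {n : ℕ} {g k : XT n → ℝ} (hg : Null g) (h : ∀ z, g z = k z) : Null k := by
  have : g = k := funext h
  rwa [← this]

/-- space direction -/
def eX {n : ℕ} (i : Fin n) : XT n := (Pi.single i 1, 0)
/-- time direction -/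
def eT {n : ℕ} : XT n := (0, 1)

structure TestFn (n : ℕ) where
  φ : XT n → ℝ
  φt : XT n → ℝ
  φi : Fin n → XT n → ℝ
  φii : Fin n → XT n → ℝ
  nonneg : ∀ z, 0 ≤ φ z
  cpt : HasCompactSupport φ
  cont : Continuous φ
  contt : Continuous φt
  conti : ∀ i, Continuous (φi i)
  contii : ∀ i, Continuous (φii i)
  ldt : LD φ φt eT
  ldi : ∀ i, LD φ (φi i) (eX i)
  ldii : ∀ i, LD (φi i) (φii i) (eX i)

/-- regular functions: with continuous pure derivatives -/
structure Reg (n : ℕ) where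
  w : XT n → ℝ
  wt : XT n → ℝ
  wi : Fin n → XT n → ℝ
  wii : Fin n → XT n → ℝ
  cont : Continuous w
  contt : Continuous wt
  conti : ∀ i, Continuous (wi i)
  contii : ∀ i, Continuous (wii i)
  ldt : LD w wt eT
  ldi : ∀ i, LD w (wi i) (eX i)
  ldii : ∀ i, LD (wi i) (wii i) (eX i)

open scoped ContDiff Convolution

theorem D_contDiff {n : ℕ} {W : XT n → ℝ} (hW : ContDiff ℝ ∞ W) (e : XT n) :
    ContDiff ℝ ∞ (fun z => fderiv ℝ W z e) := by
  have h : ContDiff ℝ ∞ (fderiv ℝ W) := hW.fderiv_right (by simp)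
  exact h.clm_apply contDiff_const

theorem D_comm {n : ℕ} {W : XT n → ℝ} (hW : ContDiff ℝ ∞ W) (e e' : XT n) (z : XT n) :
    fderiv ℝ (fun z => fderiv ℝ W z e) z e' = fderiv ℝ (fun z => fderiv ℝ W z e') z e := by
  have h : ContDiff ℝ ∞ (fderiv ℝ W) := hW.fderiv_right (by simp)
  have hd : DifferentiableAt ℝ (fderiv ℝ W) z := (h.differentiable (by simp)) z
  have hs : IsSymmSndFDerivAt ℝ W z := hW.contDiffAt.isSymmSndFDerivAt (by
    simp only [minSmoothness_of_isRCLikeNormedField]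
    exact WithTop.coe_le_coe.2 le_top)
  rw [fderiv_clm_apply hd (by fun_prop), fderiv_clm_apply hd (by fun_prop)]
  simpa using hs e' e

theorem moll_LD {n : ℕ} {U U' ρ : XT n → ℝ} {e : XT n} (hU : LD U U' e) (cU : Continuous U)
    (cU' : Continuous U') (hρ : ContDiff ℝ ∞ ρ) (hc : HasCompactSupport ρ) (z : XT n) :
    fderiv ℝ (ρ ⋆[ContinuousLinearMap.lsmul ℝ ℝ, volume] U) z e =
      (ρ ⋆[ContinuousLinearMap.lsmul ℝ ℝ, volume] U') z := by
  have hρ1 : ContDiff ℝ 1 ρ := hρ.of_le (by simp)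
  have h1 := hc.hasFDerivAt_convolution_left (ContinuousLinearMap.lsmul ℝ ℝ) (μ := volume) hρ1
    cU.locallyIntegrable z
  rw [h1.fderiv]
  have cD : Continuous (fderiv ℝ ρ) := hρ1.continuous_fderiv (by simp)
  have hcD : HasCompactSupport (fderiv ℝ ρ) := hc.fderiv ℝ
  have h2 : (fderiv ℝ ρ ⋆[(ContinuousLinearMap.lsmul ℝ ℝ).precompL (XT n), volume] U) z e
      = ∫ y, fderiv ℝ ρ y e * U (z - y) := by
    rw [convolution_def, ContinuousLinearMap.integral_apply]
    · simp [ContinuousLinearMap.precompL_apply]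
    · exact hcD.convolutionExists_left _ cD cU.locallyIntegrable z
  rw [h2, convolution_def]
  simp only [ContinuousLinearMap.lsmul_apply, smul_eq_mul]
  have hL1 : LD ρ (fun z => fderiv ℝ ρ z e) e := LD.of_diff (hρ.differentiable (by simp)) e
  have hL2 : LD (fun y => U (z - y)) (fun y => - U' (z - y)) e := by
    intro y
    have h3 := hU (z - y)
    have h4 : HasDerivAt (fun s : ℝ => U (z - y + s • e)) (U' (z - y)) (-0) := by simpa using h3
    have h5 := HasDerivAt.scomp (h := fun s : ℝ => -s) (0:ℝ) h4 (hasDerivAt_neg (0:ℝ))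
    have h6 : ((fun s : ℝ => U (z - y + s • e)) ∘ fun s : ℝ => -s) =
        fun s : ℝ => U (z - (y + s • e)) := by
      funext s
      simp only [Function.comp]
      congr 1
      module
    rw [h6] at h5
    simpa using h5
  have cDe : Continuous (fun z => fderiv ℝ ρ z e) := by fun_prop
  have cρ := hρ.continuous
  have hN := (hL1.mul hL2).null (hc.mul_right) (by fun_prop) (by fun_prop)
  have i1 : Integrable (fun y => fderiv ℝ ρ y e * U (z - y)) :=
    Continuous.integrable_of_hasCompactSupport (by fun_prop) ((hL1.compact hc).mul_right)
  have i2 : Integrable (fun y => ρ y * -U' (z - y)) :=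
    Continuous.integrable_of_hasCompactSupport (by fun_prop) (hc.mul_right)
  have h7 := hN.2
  rw [integral_add i1 i2] at h7
  have h8 : ∫ y, ρ y * -U' (z - y) = - ∫ y, ρ y * U' (z - y) := by
    rw [← integral_neg]; congr 1; funext y; ring
  linarith

open scoped ContDiff Convolution

/-- The Bernstein type integrand. -/
noncomputable def Pint {n : ℕ} (T : TestFn n) (κ ε : ℝ) (z : XT n) (w : ℝ) (wi wii : Fin n → ℝ) : ℝ :=
  T.φ z * ((κ ^ 2 * (((n : ℝ) - 1) / n) + κ) * ((|w| + ε)⁻¹) ^ 2 * (∑ i, wi i ^ 2) ^ 2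
    - κ * (((n : ℝ) + 2) / n) * (|w| + ε)⁻¹ * (∑ i, wi i ^ 2) * (∑ i, wii i)
    + ((n : ℝ) - 1) / n * (∑ i, wii i) ^ 2)
  + 1 / 2 * (∑ i, T.φii i z) * (∑ i, wi i ^ 2)
  + (∑ i, wii i) * (∑ i, T.φi i z * wi i)
  - κ * (|w| + ε)⁻¹ * (∑ i, wi i ^ 2) * (∑ i, T.φi i z * wi i)

theorem sum7 {n : ℕ} (c1 c2 c3 c4 c5 c6 c7 : ℝ) (a1 a2 a3 a4 a5 a6 a7 b1 b2 b3 b4 b5 b6 b7 : Fin n → ℝ) :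
    ∑ i, ∑ j, (c1 * (a1 i * b1 j) + c2 * (a2 i * b2 j) + c3 * (a3 i * b3 j) + c4 * (a4 i * b4 j)
      + c5 * (a5 i * b5 j) + c6 * (a6 i * b6 j) + c7 * (a7 i * b7 j)) =
    c1 * ((∑ i, a1 i) * ∑ i, b1 i) + c2 * ((∑ i, a2 i) * ∑ i, b2 i) + c3 * ((∑ i, a3 i) * ∑ i, b3 i)
    + c4 * ((∑ i, a4 i) * ∑ i, b4 i) + c5 * ((∑ i, a5 i) * ∑ i, b5 i) + c6 * ((∑ i, a6 i) * ∑ i, b6 i)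
    + c7 * ((∑ i, a7 i) * ∑ i, b7 i) := by
  simp only [Finset.sum_add_distrib, Finset.sum_mul_sum]
  simp only [Finset.mul_sum]

theorem trace_ineq {n : ℕ} (hn : 1 ≤ n) (A : Fin n → Fin n → ℝ) :
    (∑ i, A i i) ^ 2 / n ≤ ∑ i, ∑ j, A i j ^ 2 := by
  have hn' : (0:ℝ) < n := by exact_mod_cast hn
  rw [div_le_iff₀ hn']
  have h1 : (∑ i, A i i) ^ 2 ≤ n * ∑ i, A i i ^ 2 := by
    simpa using sq_sum_le_card_mul_sum_sq (s := Finset.univ) (f := fun i : Fin n => A i i)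
  have h2 : ∑ i, A i i ^ 2 ≤ ∑ i, ∑ j, A i j ^ 2 := by
    apply Finset.sum_le_sum
    intro i _
    exact Finset.single_le_sum (f := fun j => A i j ^ 2) (fun j _ => sq_nonneg _) (Finset.mem_univ i)
  nlinarith

theorem smooth_P {n : ℕ} (hn : 1 ≤ n) (T : TestFn n) (κ ε : ℝ) (hε : 0 < ε) {W : XT n → ℝ}
    (hW : ContDiff ℝ ∞ W) (hW0 : ∀ z, 0 ≤ W z) :
    0 ≤ ∫ z, Pint T κ ε z (W z) (fun i => fderiv ℝ W z (eX i))
      (fun i => fderiv ℝ (fun z => fderiv ℝ W z (eX i)) z (eX i)) := by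
  have hn' : (n:ℝ) ≠ 0 := by positivity
  set Wi : Fin n → XT n → ℝ := fun i z => fderiv ℝ W z (eX i) with hWi
  set Wij : Fin n → Fin n → XT n → ℝ := fun i j z => fderiv ℝ (Wi i) z (eX j) with hWij
  set Wijk : Fin n → Fin n → Fin n → XT n → ℝ := fun i j k z => fderiv ℝ (Wij i j) z (eX k) with hWijk
  have sWi : ∀ i, ContDiff ℝ ∞ (Wi i) := fun i => D_contDiff hW _
  have sWij : ∀ i j, ContDiff ℝ ∞ (Wij i j) := fun i j => D_contDiff (sWi i) _
  have sWijk : ∀ i j k, ContDiff ℝ ∞ (Wijk i j k) := fun i j k => D_contDiff (sWij i j) _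
  have cW := hW.continuous
  have cWi := fun i => (sWi i).continuous
  have cWij := fun i j => (sWij i j).continuous
  have cWijk := fun i j k => (sWijk i j k).continuous
  have lW : ∀ i, LD W (Wi i) (eX i) := fun i => LD.of_diff (hW.differentiable (by simp)) _
  have lWi : ∀ i j, LD (Wi i) (Wij i j) (eX j) := fun i j =>
    LD.of_diff ((sWi i).differentiable (by simp)) _
  have lWij : ∀ i j k, LD (Wij i j) (Wijk i j k) (eX k) := fun i j k =>
    LD.of_diff ((sWij i j).differentiable (by simp)) _
  have sym2 : ∀ i j z, Wij i j z = Wij j i z := fun i j z => D_comm hW _ _ z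
  have sym3 : ∀ i j z, Wijk i j j z = Wijk j j i z := by
    intro i j z
    have h1 : Wij i j = Wij j i := funext (sym2 i j)
    have h2 : Wijk i j j z = Wijk j i j z := by
      simp only [hWijk, h1]
    rw [h2]
    exact D_comm (sWi j) _ _ z
  have hv : ∀ z, 0 < W z + ε := fun z => by linarith [hW0 z]
  set V : XT n → ℝ := fun z => (W z + ε)⁻¹ with hV
  have cV : Continuous V := by
    apply Continuous.inv₀ (by fun_prop)
    intro z; exact (hv z).ne'
  have lV : ∀ i, LD V (fun z => -(V z) ^ 2 * Wi i z) (eX i) := by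
    intro i
    have := (lW i).comp (G := fun y => (y + ε)⁻¹) (G' := fun y => -((y + ε)⁻¹) ^ 2) (by
      intro z
      have h := ((hasDerivAt_id (W z)).add_const ε).inv (by simpa using (hv z).ne')
      have h' : -1 / (id (W z) + ε) ^ 2 = -((W z + ε)⁻¹) ^ 2 := by
        rw [inv_pow, neg_div, one_div]; rfl
      rw [h'] at h
      exact h)
    exact this
  have cφ := T.cont
  have cφi := T.conti
  have cφii := T.contii
  have Na : ∀ i j, Null (fun z => (T.φi j z * Wi i z + T.φ z * Wij i j z) * Wij i j z
      + T.φ z * Wi i z * Wijk i j j z) := fun i j =>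
    LD.null (((T.ldi j).mul (lWi i j)).mul (lWij i j j)) ((T.cpt.mul_right).mul_right)
      (by fun_prop) (by fun_prop)
  have Nb : ∀ i j, Null (fun z => (T.φi i z * Wi i z + T.φ z * Wij i i z) * Wij j j z
      + T.φ z * Wi i z * Wijk j j i z) := fun i j =>
    LD.null (((T.ldi i).mul (lWi i i)).mul (lWij j j i)) ((T.cpt.mul_right).mul_right)
      (by fun_prop) (by fun_prop)
  have Nc : ∀ i j, Null (fun z => (T.φii j z * Wi i z + T.φi j z * Wij i j z) * Wi i z
      + T.φi j z * Wi i z * Wij i j z) := fun i j =>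
    LD.null (((T.ldii j).mul (lWi i j)).mul (lWi i j))
      (((((T.ldi j).compact T.cpt)).mul_right).mul_right)
      (by fun_prop) (by fun_prop)
  have Nd : ∀ i j, Null (fun z => (((T.φi j z * V z + T.φ z * (-(V z) ^ 2 * Wi j z)) * Wi j z
      + T.φ z * V z * Wij j j z) * Wi i z + T.φ z * V z * Wi j z * Wij i j z) * Wi i z
      + T.φ z * V z * Wi j z * Wi i z * Wij i j z) := fun i j =>
    LD.null (((((T.ldi j).mul (lV j)).mul (lWi j j)).mul (lWi i j)).mul (lWi i j))
      ((((T.cpt.mul_right).mul_right).mul_right).mul_right)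
      (by fun_prop) (by fun_prop)
  have NN := Null.sum (fun i => Null.sum (fun j =>
    (((Na i j).add ((Nb i j).const_mul (-1))).add ((Nc i j).const_mul (-(1/2)))).add
      ((Nd i j).const_mul κ)))
  set P : XT n → ℝ := fun z => Pint T κ ε z (W z) (fun i => Wi i z) (fun i => Wij i i z) with hP
  have key : ∀ z, 0 ≤ P z + ∑ i, ∑ j, ((T.φi j z * Wi i z + T.φ z * Wij i j z) * Wij i j z
      + T.φ z * Wi i z * Wijk i j j z + -1 * ((T.φi i z * Wi i z + T.φ z * Wij i i z) * Wij j j z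
      + T.φ z * Wi i z * Wijk j j i z) + -(1/2) * ((T.φii j z * Wi i z + T.φi j z * Wij i j z) * Wi i z
      + T.φi j z * Wi i z * Wij i j z) + κ * ((((T.φi j z * V z + T.φ z * (-(V z) ^ 2 * Wi j z)) * Wi j z
      + T.φ z * V z * Wij j j z) * Wi i z + T.φ z * V z * Wi j z * Wij i j z) * Wi i z
      + T.φ z * V z * Wi j z * Wi i z * Wij i j z)) := by
    intro z
    have h1 := mul_le_mul_of_nonneg_left
      (trace_ineq hn (fun i j => Wij i j z + κ * V z * Wi i z * Wi j z)) (T.nonneg z)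
    have h2 : ∑ i, (Wij i i z + κ * V z * Wi i z * Wi i z) =
        (∑ i, Wij i i z) + κ * V z * ∑ i, Wi i z ^ 2 := by
      rw [Finset.sum_add_distrib, Finset.mul_sum]
      congr 1; apply Finset.sum_congr rfl; intro i _; ring
    rw [h2] at h1
    have h3 := sum7 (T.φ z) (1/2) 1 (κ * T.φ z * V z ^ 2) (-κ * T.φ z * V z) (-κ * V z)
      (κ ^ 2 * T.φ z * V z ^ 2)
      (fun i => Wij i i z) (fun i => Wi i z ^ 2) (fun i => T.φi i z * Wi i z) (fun i => Wi i z ^ 2)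
      (fun i => Wi i z ^ 2) (fun i => Wi i z ^ 2) (fun i => Wi i z ^ 2)
      (fun i => Wij i i z) (fun i => T.φii i z) (fun i => Wij i i z) (fun i => Wi i z ^ 2)
      (fun i => Wij i i z) (fun i => T.φi i z * Wi i z) (fun i => Wi i z ^ 2)
    rw [Finset.mul_sum] at h1
    simp_rw [Finset.mul_sum] at h1
    have h4 : ∑ i, ∑ j, T.φ z * (Wij i j z + κ * V z * Wi i z * Wi j z) ^ 2 =
      ∑ i, ∑ j, ((T.φi j z * Wi i z + T.φ z * Wij i j z) * Wij i j z
      + T.φ z * Wi i z * Wijk i j j z + -1 * ((T.φi i z * Wi i z + T.φ z * Wij i i z) * Wij j j z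
      + T.φ z * Wi i z * Wijk j j i z) + -(1/2) * ((T.φii j z * Wi i z + T.φi j z * Wij i j z) * Wi i z
      + T.φi j z * Wi i z * Wij i j z) + κ * ((((T.φi j z * V z + T.φ z * (-(V z) ^ 2 * Wi j z)) * Wi j z
      + T.φ z * V z * Wij j j z) * Wi i z + T.φ z * V z * Wi j z * Wij i j z) * Wi i z
      + T.φ z * V z * Wi j z * Wi i z * Wij i j z)) +
      ∑ i, ∑ j, (T.φ z * (Wij i i z * Wij j j z) + 1 / 2 * (Wi i z ^ 2 * T.φii j z) + 1 * (T.φi i z * Wi i z * Wij j j z) +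
      κ * T.φ z * V z ^ 2 * (Wi i z ^ 2 * Wi j z ^ 2) + -κ * T.φ z * V z * (Wi i z ^ 2 * Wij j j z) +
      -κ * V z * (Wi i z ^ 2 * (T.φi j z * Wi j z)) + κ ^ 2 * T.φ z * V z ^ 2 * (Wi i z ^ 2 * Wi j z ^ 2)) := by
      rw [← Finset.sum_add_distrib]
      apply Finset.sum_congr rfl; intro i _
      rw [← Finset.sum_add_distrib]
      apply Finset.sum_congr rfl; intro j _
      rw [sym3 i j z]
      ring
    rw [h4, h3] at h1
    have hPz : P z = Pint T κ ε z (W z) (fun i => Wi i z) (fun i => Wij i i z) := rfl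
    have hVz : (|W z| + ε)⁻¹ = V z := by rw [abs_of_nonneg (hW0 z)]
    rw [hPz, Pint, hVz]
    rw [← Finset.mul_sum] at h1
    generalize (∑ i, Wij i i z) = L at h1 ⊢
    generalize (∑ i, Wi i z ^ 2) = S at h1 ⊢
    generalize (∑ i, T.φi i z * Wi i z) = Q at h1 ⊢
    generalize (∑ i, T.φii i z) = Φ at h1 ⊢
    generalize T.φ z = f at h1 ⊢
    generalize V z = v at h1 ⊢
    have e1 : ((n:ℝ) - 1) / n = 1 - 1 / n := by field_simp
    have e2 : ((n:ℝ) + 2) / n = 1 + 2 * (1 / n) := by field_simp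
    rw [e1, e2]
    rw [div_eq_mul_one_div] at h1
    generalize 1 / (n:ℝ) = r at h1 ⊢
    linarith
  have iP : Integrable P := by
    apply Continuous.integrable_of_hasCompactSupport
    · have : P = fun z => Pint T κ ε z (W z) (fun i => Wi i z) (fun i => Wij i i z) := rfl
      rw [this]; unfold Pint
      have cV' : Continuous (fun z => (|W z| + ε)⁻¹) := by
        apply Continuous.inv₀ (by fun_prop)
        intro z; have := abs_nonneg (W z); positivity
      fun_prop
    · apply HasCompactSupport.intro T.cpt
      intro z hz
      have e0 : T.φ z = 0 := image_eq_zero_of_notMem_tsupport hz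
      have e1 : ∀ i, T.φi i z = 0 := fun i => (T.ldi i).zero_off hz
      have e2 : ∀ i, T.φii i z = 0 := fun i => (T.ldii i).zero_off (by
        intro h
        apply hz
        have : tsupport (T.φi i) ⊆ tsupport T.φ :=
          closure_minimal (fun y hy => by
            by_contra h'; exact hy ((T.ldi i).zero_off h')) (isClosed_tsupport _)
        exact this h)
      simp [hP, Pint, e0, e1, e2]
  have h5 := integral_nonneg (μ := volume) (Pi.le_def.2 key)
  rw [integral_add iP NN.1, NN.2, add_zero] at h5
  exact h5

theorem smooth_T {n : ℕ} (T : TestFn n) {W : XT n → ℝ} (hW : ContDiff ℝ ∞ W) :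
    Null (fun z => T.φ z * fderiv ℝ W z eT *
        (∑ i, fderiv ℝ (fun z => fderiv ℝ W z (eX i)) z (eX i))
      - 1 / 2 * T.φt z * (∑ i, (fderiv ℝ W z (eX i)) ^ 2)
      + fderiv ℝ W z eT * (∑ i, T.φi i z * fderiv ℝ W z (eX i))) := by
  set Wi : Fin n → XT n → ℝ := fun i z => fderiv ℝ W z (eX i) with hWi
  set Wt : XT n → ℝ := fun z => fderiv ℝ W z eT with hWt
  have sWi : ∀ i, ContDiff ℝ ∞ (Wi i) := fun i => D_contDiff hW _
  have sWt : ContDiff ℝ ∞ Wt := D_contDiff hW _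
  have cWi := fun i => (sWi i).continuous
  have cWt := sWt.continuous
  have cWii := fun i => (D_contDiff (sWi i) (eX i)).continuous
  have cWit := fun i => (D_contDiff (sWi i) eT).continuous
  have cWti := fun i => (D_contDiff sWt (eX i)).continuous
  have cφ := T.cont
  have cφi := T.conti
  have cφt := T.contt
  have N1 := fun i => LD.null (((T.ldi i).mul (LD.of_diff (sWt.differentiable (by simp)) (eX i))).mul
    (LD.of_diff ((sWi i).differentiable (by simp)) (eX i))) ((T.cpt.mul_right).mul_right)
      (by fun_prop) (by fun_prop)
  have N2 := fun i => LD.null (((T.ldt).mul (LD.of_diff ((sWi i).differentiable (by simp)) eT)).mul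
    (LD.of_diff ((sWi i).differentiable (by simp)) eT)) ((T.cpt.mul_right).mul_right)
      (by fun_prop) (by fun_prop)
  refine (Null.sum (fun i => (N1 i).add ((N2 i).const_mul (-(1/2))))).congr ?_
  intro z
  simp only [Finset.mul_sum]
  rw [← Finset.sum_sub_distrib, ← Finset.sum_add_distrib]
  apply Finset.sum_congr rfl
  intro i _
  have : fderiv ℝ Wt z (eX i) = fderiv ℝ (Wi i) z eT := D_comm hW _ _ z
  simp only [this]
  ring

open scoped ContDiff Convolution

noncomputable def bumpK (n : ℕ) (k : ℕ) : ContDiffBump (0 : XT n) where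
  rIn := 1 / (2 * ((k : ℝ) + 1))
  rOut := 1 / ((k : ℝ) + 1)
  rIn_pos := by positivity
  rIn_lt_rOut := by
    apply one_div_lt_one_div_of_lt <;> [positivity; linarith [(Nat.cast_nonneg k : (0:ℝ) ≤ k)]]

noncomputable def mol {n : ℕ} (k : ℕ) (g : XT n → ℝ) : XT n → ℝ :=
  (bumpK n k).normed volume ⋆[ContinuousLinearMap.lsmul ℝ ℝ, volume] g

theorem mol_smooth {n : ℕ} (k : ℕ) {g : XT n → ℝ} (hg : Continuous g) :
    ContDiff ℝ ∞ (mol k g) :=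
  HasCompactSupport.contDiff_convolution_left _ ((bumpK n k).hasCompactSupport_normed)
    ((bumpK n k).contDiff_normed) hg.locallyIntegrable

theorem mol_nonneg {n : ℕ} (k : ℕ) {g : XT n → ℝ} (hg : ∀ z, 0 ≤ g z) (z : XT n) :
    0 ≤ mol k g z := by
  unfold mol
  rw [convolution_def]
  apply integral_nonneg
  intro y
  simp only [ContinuousLinearMap.lsmul_apply, smul_eq_mul, Pi.zero_apply]
  exact mul_nonneg ((bumpK n k).nonneg_normed y) (hg _)

theorem mol_tendsto {n : ℕ} {g : XT n → ℝ} (hg : Continuous g) (z : XT n) :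
    Tendsto (fun k => mol k g z) atTop (nhds (g z)) := by
  apply ContDiffBump.convolution_tendsto_right_of_continuous _ hg
  exact tendsto_one_div_add_atTop_nhds_zero_nat

theorem mol_bound {n : ℕ} {g : XT n → ℝ} (hg : Continuous g) {K : Set (XT n)} (hK : IsCompact K) :
    ∃ C, ∀ k, ∀ z ∈ K, mol k g z ∈ Icc (-C) C := by
  have hK' : IsCompact (Metric.cthickening 1 K) := hK.cthickening
  obtain ⟨C, hC⟩ := hK'.exists_bound_of_continuousOn hg.continuousOn
  refine ⟨3 * C, fun k z hz => ?_⟩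
  have hzK : z ∈ Metric.cthickening 1 K := Metric.self_subset_cthickening _ hz
  have h1 : dist (mol k g z) (g z) ≤ 2 * C := by
    apply ContDiffBump.dist_normed_convolution_le hg.aestronglyMeasurable
    intro x hx
    have hx1 : dist x z ≤ 1 := by
      have : (bumpK n k).rOut ≤ 1 := by
        simp only [bumpK]
        rw [div_le_one (by positivity)]
        linarith [(Nat.cast_nonneg k : (0:ℝ) ≤ k)]
      exact (Metric.mem_ball.1 hx).le.trans this
    have hxK : x ∈ Metric.cthickening 1 K := Metric.mem_cthickening_of_dist_le x z 1 K hz hx1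
    rw [dist_eq_norm]
    calc ‖g x - g z‖ ≤ ‖g x‖ + ‖g z‖ := norm_sub_le _ _
      _ ≤ 2 * C := by linarith [hC x hxK, hC z hzK]
  have h2 := hC z hzK
  rw [Real.dist_eq] at h1
  rw [Real.norm_eq_abs] at h2
  rw [abs_le] at h1 h2
  constructor <;> linarith

theorem mol_D {n : ℕ} (k : ℕ) {g g' : XT n → ℝ} {e : XT n} (h : LD g g' e) (cg : Continuous g)
    (cg' : Continuous g') : (fun z => fderiv ℝ (mol k g) z e) = mol k g' := by
  funext z
  exact moll_LD h cg cg' ((bumpK n k).contDiff_normed) ((bumpK n k).hasCompactSupport_normed) z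

theorem mol_limit {n : ℕ} (u : Reg n) {K : Set (XT n)} (hK : IsCompact K)
    (H : XT n → ℝ → ℝ → (Fin n → ℝ) → (Fin n → ℝ) → ℝ)
    (hH : Continuous (fun q : XT n × ℝ × ℝ × (Fin n → ℝ) × (Fin n → ℝ) =>
      H q.1 q.2.1 q.2.2.1 q.2.2.2.1 q.2.2.2.2))
    (hz : ∀ z, z ∉ K → ∀ a b c d, H z a b c d = 0) :
    Tendsto (fun k => ∫ z, H z (mol k u.w z) (fderiv ℝ (mol k u.w) z eT)
      (fun i => fderiv ℝ (mol k u.w) z (eX i))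
      (fun i => fderiv ℝ (fun z => fderiv ℝ (mol k u.w) z (eX i)) z (eX i))) atTop
      (nhds (∫ z, H z (u.w z) (u.wt z) (fun i => u.wi i z) (fun i => u.wii i z))) := by
  have e1 : ∀ k z, fderiv ℝ (mol k u.w) z eT = mol k u.wt z := fun k z =>
    congrFun (mol_D k u.ldt u.cont u.contt) z
  have e2 : ∀ k i, (fun z => fderiv ℝ (mol k u.w) z (eX i)) = mol k (u.wi i) := fun k i =>
    mol_D k (u.ldi i) u.cont (u.conti i)
  have e3 : ∀ k i z, fderiv ℝ (fun z => fderiv ℝ (mol k u.w) z (eX i)) z (eX i)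
      = mol k (u.wii i) z := fun k i z => by
    rw [e2]; exact congrFun (mol_D k (u.ldii i) (u.conti i) (u.contii i)) z
  have e2' : ∀ k i z, fderiv ℝ (mol k u.w) z (eX i) = mol k (u.wi i) z := fun k i z =>
    congrFun (e2 k i) z
  simp only [e1, e3]
  simp only [e2']
  obtain ⟨C1, h1⟩ := mol_bound u.cont hK
  obtain ⟨C2, h2⟩ := mol_bound u.contt hK
  choose C3 h3 using fun i => mol_bound (u.conti i) hK
  choose C4 h4 using fun i => mol_bound (u.contii i) hK
  have hB : IsCompact (K ×ˢ (Icc (-C1) C1 ×ˢ (Icc (-C2) C2 ×ˢ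
      ((univ.pi fun i => Icc (-C3 i) (C3 i)) ×ˢ (univ.pi fun i => Icc (-C4 i) (C4 i)))))) :=
    hK.prod (isCompact_Icc.prod (isCompact_Icc.prod
      ((isCompact_univ_pi fun i => isCompact_Icc).prod (isCompact_univ_pi fun i => isCompact_Icc))))
  obtain ⟨M, hM⟩ := hB.exists_bound_of_continuousOn hH.continuousOn
  have cm : ∀ k {g : XT n → ℝ}, Continuous g → Continuous (mol k g) := fun k g hg =>
    (mol_smooth k hg).continuous
  apply tendsto_integral_of_dominated_convergence (K.indicator fun _ => M)
  · intro k
    apply Continuous.aestronglyMeasurable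
    exact hH.comp (continuous_id.prodMk ((cm k u.cont).prodMk ((cm k u.contt).prodMk
      ((continuous_pi fun i => cm k (u.conti i)).prodMk (continuous_pi fun i => cm k (u.contii i))))))
  · rw [integrable_indicator_iff hK.measurableSet]
    exact integrableOn_const hK.measure_lt_top.ne
  · intro k
    filter_upwards with z
    by_cases hzK : z ∈ K
    · rw [indicator_of_mem hzK]
      exact hM (z, mol k u.w z, mol k u.wt z, fun i => mol k (u.wi i) z, fun i => mol k (u.wii i) z)
        ⟨hzK, h1 k z hzK, h2 k z hzK, fun i _ => h3 i k z hzK, fun i _ => h4 i k z hzK⟩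
    · rw [indicator_of_notMem hzK, hz z hzK]; simp
  · filter_upwards with z
    have := ((hH.tendsto (z, u.w z, u.wt z, (fun i => u.wi i z), (fun i => u.wii i z)))).comp
      ((tendsto_const_nhds (x := z) (f := atTop (α := ℕ))).prodMk_nhds
        ((mol_tendsto u.cont z).prodMk_nhds ((mol_tendsto u.contt z).prodMk_nhds
        ((tendsto_pi_nhds.2 fun i => mol_tendsto (u.conti i) z).prodMk_nhds
          (tendsto_pi_nhds.2 fun i => mol_tendsto (u.contii i) z)))))
    exact this

theorem TestFn.zero {n : ℕ} (T : TestFn n) {z : XT n} (hz : z ∉ tsupport T.φ) :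
    T.φ z = 0 ∧ T.φt z = 0 ∧ (∀ i, T.φi i z = 0) ∧ (∀ i, T.φii i z = 0) := by
  refine ⟨image_eq_zero_of_notMem_tsupport hz, T.ldt.zero_off hz, fun i => (T.ldi i).zero_off hz,
    fun i => (T.ldii i).zero_off ?_⟩
  intro h
  apply hz
  have : tsupport (T.φi i) ⊆ tsupport T.φ :=
    closure_minimal (fun y hy => by
      by_contra h'; exact hy ((T.ldi i).zero_off h')) (isClosed_tsupport _)
  exact this h

theorem Pint_cont {n : ℕ} (T : TestFn n) (κ ε : ℝ) (hε : 0 < ε) :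
    Continuous (fun q : XT n × ℝ × ℝ × (Fin n → ℝ) × (Fin n → ℝ) =>
      Pint T κ ε q.1 q.2.1 q.2.2.2.1 q.2.2.2.2) := by
  unfold Pint
  have cV' : Continuous (fun q : XT n × ℝ × ℝ × (Fin n → ℝ) × (Fin n → ℝ) => (|q.2.1| + ε)⁻¹) := by
    apply Continuous.inv₀ (by fun_prop)
    intro z; have := abs_nonneg z.2.1; positivity
  have cφ := T.cont
  have cφi := T.conti
  have cφii := T.contii
  fun_prop

theorem reg_P {n : ℕ} (hn : 1 ≤ n) (T : TestFn n) (κ ε : ℝ) (hε : 0 < ε) (u : Reg n)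
    (hu : ∀ z, 0 ≤ u.w z) :
    Integrable (fun z => Pint T κ ε z (u.w z) (fun i => u.wi i z) (fun i => u.wii i z)) ∧
    0 ≤ ∫ z, Pint T κ ε z (u.w z) (fun i => u.wi i z) (fun i => u.wii i z) := by
  have h0 : ∀ z, z ∉ tsupport T.φ → ∀ a (c d : Fin n → ℝ), Pint T κ ε z a c d = 0 := by
    intro z hz a c d
    obtain ⟨e0, -, e1, e2⟩ := T.zero hz
    simp [Pint, e0, e1, e2]
  constructor
  · apply Continuous.integrable_of_hasCompactSupport
    · exact (Pint_cont T κ ε hε).comp (continuous_id.prodMk (u.cont.prodMk (u.contt.prodMk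
        ((continuous_pi fun i => u.conti i).prodMk (continuous_pi fun i => u.contii i)))))
    · exact HasCompactSupport.intro T.cpt (fun z hz => h0 z hz _ _ _)
  · apply ge_of_tendsto (mol_limit u T.cpt.isCompact (fun z a _ c d => Pint T κ ε z a c d)
      (Pint_cont T κ ε hε) (fun z hz a _ c d => h0 z hz a c d))
    filter_upwards with k
    exact smooth_P hn T κ ε hε (mol_smooth k u.cont) (mol_nonneg k hu)

theorem reg_T {n : ℕ} (T : TestFn n) (u : Reg n) :
    Null (fun z => T.φ z * u.wt z * (∑ i, u.wii i z)
      - 1 / 2 * T.φt z * (∑ i, (u.wi i z) ^ 2)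
      + u.wt z * (∑ i, T.φi i z * u.wi i z)) := by
  set H : XT n → ℝ → ℝ → (Fin n → ℝ) → (Fin n → ℝ) → ℝ := fun z _ b c d =>
    T.φ z * b * (∑ i, d i) - 1 / 2 * T.φt z * (∑ i, (c i) ^ 2) + b * (∑ i, T.φi i z * c i) with hHd
  have cφ := T.cont
  have cφi := T.conti
  have cφt := T.contt
  have hH : Continuous (fun q : XT n × ℝ × ℝ × (Fin n → ℝ) × (Fin n → ℝ) =>
      H q.1 q.2.1 q.2.2.1 q.2.2.2.1 q.2.2.2.2) := by
    simp only [hHd]; fun_prop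
  have h0 : ∀ z, z ∉ tsupport T.φ → ∀ a b c d, H z a b c d = 0 := by
    intro z hz a b c d
    obtain ⟨e0, e3, e1, e2⟩ := T.zero hz
    simp [hHd, e0, e1, e3]
  constructor
  · apply Continuous.integrable_of_hasCompactSupport
    · exact hH.comp (continuous_id.prodMk (u.cont.prodMk (u.contt.prodMk
        ((continuous_pi fun i => u.conti i).prodMk (continuous_pi fun i => u.contii i)))))
    · exact HasCompactSupport.intro T.cpt (fun z hz => h0 z hz (u.w z) _ _ _)
  · have h1 := mol_limit u T.cpt.isCompact H hH h0
    have h2 : ∀ k, (∫ z, H z (mol k u.w z) (fderiv ℝ (mol k u.w) z eT)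
      (fun i => fderiv ℝ (mol k u.w) z (eX i))
      (fun i => fderiv ℝ (fun z => fderiv ℝ (mol k u.w) z (eX i)) z (eX i))) = 0 := fun k =>
      (smooth_T T (mol_smooth k u.cont)).2
    simp only [h2] at h1
    exact tendsto_nhds_unique h1 tendsto_const_nhds

/-- divergence identity for a function of `u` in space -/
theorem reg_G {n : ℕ} (T : TestFn n) (u : Reg n) (G G' : ℝ → ℝ) (hG : ∀ y, HasDerivAt G (G' y) y)
    (cG' : Continuous G') :
    Null (fun z => T.φ z * G (u.w z) * (∑ i, u.wii i z) + T.φ z * G' (u.w z) * (∑ i, u.wi i z ^ 2)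
      + G (u.w z) * (∑ i, T.φi i z * u.wi i z)) := by
  have cG : Continuous G := continuous_iff_continuousAt.2 fun y => (hG y).continuousAt
  have cφ := T.cont
  have cφi := T.conti
  have c1 := u.cont
  have c2 := u.conti
  have c3 := u.contii
  refine (Null.sum (fun i => LD.null (((T.ldi i).mul ((u.ldi i).comp (fun z => hG (u.w z)))).mul
    (u.ldii i)) ((T.cpt.mul_right).mul_right) (by fun_prop) (by fun_prop))).congr ?_
  intro z
  simp only [Finset.mul_sum]
  rw [← Finset.sum_add_distrib, ← Finset.sum_add_distrib]
  apply Finset.sum_congr rfl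
  intro i _
  ring

theorem reg_F {n : ℕ} (T : TestFn n) (u : Reg n) (F f : ℝ → ℝ) (hF : ∀ y, HasDerivAt F (f y) y)
    (cf : Continuous f) :
    Null (fun z => f (u.w z) * (∑ i, T.φi i z * u.wi i z) + F (u.w z) * (∑ i, T.φii i z)) := by
  have cF : Continuous F := continuous_iff_continuousAt.2 fun y => (hF y).continuousAt
  have cφ := T.contii
  have cφi := T.conti
  have c1 := u.cont
  have c2 := u.conti
  refine (Null.sum (fun i => LD.null ((T.ldii i).mul ((u.ldi i).comp (fun z => hF (u.w z))))
    (((T.ldi i).compact T.cpt).mul_right) (by fun_prop) (by fun_prop))).congr ?_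
  intro z
  simp only [Finset.mul_sum]
  rw [← Finset.sum_add_distrib]
  apply Finset.sum_congr rfl
  intro i _
  ring

theorem reg_t {n : ℕ} (T : TestFn n) (u : Reg n) (F f : ℝ → ℝ) (hF : ∀ y, HasDerivAt F (f y) y)
    (cf : Continuous f) :
    Null (fun z => T.φ z * f (u.w z) * u.wt z + T.φt z * F (u.w z)) := by
  have cF : Continuous F := continuous_iff_continuousAt.2 fun y => (hF y).continuousAt
  have cφ := T.cont
  have cφi := T.contt
  have c1 := u.cont
  have c2 := u.contt
  refine (LD.null (T.ldt.mul (u.ldt.comp (fun z => hF (u.w z))))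
    (T.cpt.mul_right) (by fun_prop) (by fun_prop)).congr ?_
  intro z
  ring

open scoped ContDiff Convolution

theorem yg1 {y w : ℝ} (hy : 0 ≤ y) (hw : 0 ≤ w) : y ^ 3 * w ≤ y ^ 4 + w ^ 4 := by
  rcases le_total w y with h | h
  · have : y ^ 3 * w ≤ y ^ 3 * y := by gcongr
    nlinarith [pow_nonneg hw 4]
  · have : y ^ 3 * w ≤ w ^ 3 * w := by gcongr
    nlinarith [pow_nonneg hy 4]

theorem yg2 {d : ℝ} (hd : 0 < d) (c : ℝ) (hc : 0 ≤ c) : ∃ C : ℝ, 0 ≤ C ∧ ∀ y w : ℝ, 0 ≤ y → 0 ≤ w →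
    c * (y ^ 3 * w) ≤ d * w ^ 4 + C * y ^ 4 := by
  set l : ℝ := c / d + 1 with hl
  have hl1 : 1 ≤ l := by have : 0 ≤ c / d := by positivity
                         linarith
  have hcd : c ≤ d * l := by
    rw [hl, mul_add, mul_div_cancel₀ _ hd.ne']; linarith
  refine ⟨c * l, by positivity, ?_⟩
  intro y w hy hw
  rcases le_total w (l * y) with h | h
  · have h2 : c * (y ^ 3 * w) ≤ c * (y ^ 3 * (l * y)) := by gcongr
    have : 0 ≤ d * w ^ 4 := by positivity
    linarith
  · have hyw : y ≤ w := by nlinarith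
    have h1 : y ^ 2 * (l * y) ≤ w ^ 2 * w := by gcongr
    have h2 : c * (y ^ 3 * w) ≤ d * l * (y ^ 3 * w) := by gcongr
    have h3 : d * w * (y ^ 2 * (l * y)) ≤ d * w * (w ^ 2 * w) := by gcongr
    have : 0 ≤ c * l * y ^ 4 := by positivity
    linarith

theorem young_poly {A B c1 c2 c3 c4 c5 : ℝ} (hA : 0 < A) (h1 : 0 ≤ c1)
    (h2 : 0 ≤ c2) (h3 : 0 ≤ c3) :
    ∃ C : ℝ, 0 ≤ C ∧ ∀ w s y t : ℝ, 0 ≤ w → 0 ≤ s → 0 ≤ y → 0 ≤ t →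
      -A * w ^ 4 + B * (w ^ 2 * t) + c1 * (y ^ 3 * w) + c2 * (y ^ 3 * s) + c3 * (w ^ 2 * s ^ 2)
        + c4 * (t * (w * s)) + c5 * (w ^ 3 * s) - (B ^ 2 / A + 1) * t ^ 2 ≤ C * (s ^ 4 + y ^ 4) := by
  obtain ⟨C1, hC1, H1⟩ := yg2 (d := A / 4) (by positivity) c1 h1
  set c6 : ℝ := c3 + c4 ^ 2 / 4 + c5 ^ 2 / A with hc6
  have h6 : 0 ≤ c6 := by positivity
  refine ⟨C1 + c2 + c6 ^ 2 / A, by positivity, ?_⟩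
  intro w s y t hw hs hy ht
  have e1 := H1 y w hy hw
  have e2 : c2 * (y ^ 3 * s) ≤ c2 * (y ^ 4 + s ^ 4) :=
    mul_le_mul_of_nonneg_left (yg1 hy hs) h2
  have e3 : B * (w ^ 2 * t) ≤ A / 4 * w ^ 4 + B ^ 2 / A * t ^ 2 := by
    have : A / 4 * w ^ 4 + B ^ 2 / A * t ^ 2 - B * (w ^ 2 * t) = A * (w ^ 2 / 2 - B / A * t) ^ 2 := by
      field_simp; ring
    have := mul_nonneg hA.le (sq_nonneg (w ^ 2 / 2 - B / A * t))
    linarith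
  have e4 : c4 * (t * (w * s)) ≤ t ^ 2 + c4 ^ 2 / 4 * (w ^ 2 * s ^ 2) := by
    nlinarith [sq_nonneg (t - c4 / 2 * (w * s))]
  have e5 : c5 * (w ^ 3 * s) ≤ A / 4 * w ^ 4 + c5 ^ 2 / A * (w ^ 2 * s ^ 2) := by
    have : A / 4 * w ^ 4 + c5 ^ 2 / A * (w ^ 2 * s ^ 2) - c5 * (w ^ 3 * s)
        = A * (w ^ 2 / 2 - c5 / A * (w * s)) ^ 2 := by
      field_simp; ring
    have := mul_nonneg hA.le (sq_nonneg (w ^ 2 / 2 - c5 / A * (w * s)))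
    linarith
  have e6 : c6 * (w ^ 2 * s ^ 2) ≤ A / 4 * w ^ 4 + c6 ^ 2 / A * s ^ 4 := by
    have : A / 4 * w ^ 4 + c6 ^ 2 / A * s ^ 4 - c6 * (w ^ 2 * s ^ 2)
        = A * (w ^ 2 / 2 - c6 / A * s ^ 2) ^ 2 := by
      field_simp; ring
    have := mul_nonneg hA.le (sq_nonneg (w ^ 2 / 2 - c6 / A * s ^ 2))
    linarith
  have e7 : 0 ≤ C1 * s ^ 4 := by positivity
  have e8 : 0 ≤ c6 ^ 2 / A * y ^ 4 := by positivity
  have e9 : c6 * (w ^ 2 * s ^ 2) = c3 * (w ^ 2 * s ^ 2) + c4 ^ 2 / 4 * (w ^ 2 * s ^ 2)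
      + c5 ^ 2 / A * (w ^ 2 * s ^ 2) := by rw [hc6]; ring
  linarith

/-- the fixed-`ε` integral estimate -/
theorem main_eps {n : ℕ} (hn : 1 ≤ n) {a c0 : ℝ} (ha : 0 < a) (hc0 : 0 ≤ c0)
    (hA : 0 < a - ((n : ℝ) - 1) / n * a ^ 2) :
    ∃ C : ℝ, 0 ≤ C ∧ ∀ (T : TestFn n) (h : XT n → ℝ) (u : Reg n) (ε : ℝ)
      (f ft G GG F : ℝ → ℝ) (E : XT n → ℝ),
      (∀ z, 0 ≤ h z) →
      (∀ i z, |T.φi i z| ≤ c0 * (h z * T.φ z)) →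
      (∀ z, |∑ i, T.φii i z| ≤ c0 * (h z ^ 2 * T.φ z)) →
      (∀ z, |T.φt z| ≤ c0 * (h z ^ 2 * T.φ z)) →
      (∀ z, 0 ≤ u.w z) → 0 < ε → Continuous f →
      (∀ z, u.wt z - ∑ i, u.wii i z = f (u.w z)) →
      (∀ y, HasDerivAt G (f y * (|y| + ε)⁻¹) y) →
      (∀ y, HasDerivAt GG (G y) y) →
      (∀ y, HasDerivAt F (f y) y) →
      (∀ y, 0 ≤ y → 0 ≤ ft y ∧ 0 ≤ G y ∧ G y ≤ ft y ∧ 0 ≤ GG y ∧ GG y ≤ y * ft y ∧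
        0 ≤ F y ∧ F y ≤ y * ft y) →
      Integrable E →
      (∀ z, T.φ z * ((u.w z + ε) ^ 2 * h z ^ 4 +
        ((ft (u.w z) * √(u.w z + ε) * h z) ^ (1 / 3 : ℝ)) ^ 4) ≤ E z) →
      ∫ z, T.φ z * (((n : ℝ) + 2) / n * a * (G (u.w z) * f (u.w z))
        - ((n : ℝ) - 1) / n * f (u.w z) ^ 2) ≤ C * ∫ z, E z := by
  have hn1 : (1:ℝ) ≤ n := by exact_mod_cast hn
  have hn0 : (0:ℝ) < n := by linarith
  set γ : ℝ := ((n : ℝ) - 1) / n with hγ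
  have hγ0 : 0 ≤ γ := div_nonneg (by linarith) hn0.le
  set B : ℝ := ((n : ℝ) + 2) / n * a with hB
  have hB0 : 0 ≤ B := by positivity
  set A : ℝ := a - γ * a ^ 2 with hAd
  set M : ℝ := B ^ 2 / A + 1 with hM
  have hM0 : 0 ≤ M := by positivity
  set c : ℝ := c0 * n with hc
  have hcn : 0 ≤ c := by positivity
  obtain ⟨C, hC, HC⟩ := young_poly (A := A) (B := B) (c1 := B * c)
    (c2 := B * c0 + γ * c0 + c0 + M * c0) (c3 := (γ / 2 + M / 2 + 1 / 2) * c0)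
    (c4 := (γ + 1 + M) * c) (c5 := a * c) hA (by positivity) (by positivity) (by positivity)
  refine ⟨C, hC, ?_⟩
  intro T h u ε f ft G GG F E hh bi bii bt hu hε cf heq hG hGG hF hbd iE hE
  have cabs : Continuous (fun y : ℝ => (|y| + ε)⁻¹) := by
    apply Continuous.inv₀ (by fun_prop)
    intro y; have := abs_nonneg y; positivity
  have cG : Continuous G := continuous_iff_continuousAt.2 fun y => (hG y).continuousAt
  obtain ⟨iP, hP⟩ := reg_P hn T (-a) ε hε u hu
  have N2 := reg_T T u
  have N3 := reg_G T u G _ hG (by fun_prop)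
  have N4 := reg_t T u GG G hGG cG
  have N5 := reg_t T u F f hF cf
  have N6 := reg_F T u F f hF cf
  have NN := ((((N3.const_mul B).add (N4.const_mul (-B))).add (N2.const_mul (-γ - M))).add
    (N5.const_mul (γ - M))).add N6
  have c1 := u.cont
  have c2 := T.cont
  have iL : Integrable (fun z => T.φ z * (B * (G (u.w z) * f (u.w z)) - γ * f (u.w z) ^ 2)) :=
    Continuous.integrable_of_hasCompactSupport (by fun_prop) (T.cpt.mul_right)
  have hJ := integral_add iP NN.1
  rw [NN.2, add_zero] at hJ
  rw [← hJ] at hP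
  have hle := integral_mono (iP.add NN.1) ((iE.const_mul C).sub iL) (by
    intro z
    simp only [Pi.add_apply, Pi.sub_apply, Pint]
    have hv : 0 < u.w z + ε := by linarith [hu z]
    rw [abs_of_nonneg (hu z)]
    have hL : ∑ i, u.wii i z = u.wt z - f (u.w z) := by linarith [heq z]
    obtain ⟨b1, b2, b3, b4, b5, b6, b7⟩ := hbd (u.w z) (hu z)
    have hEz := hE z
    have hQ : |∑ i, T.φi i z * u.wi i z| ≤ c * (h z * T.φ z * √(∑ i, u.wi i z ^ 2)) := by
      calc |∑ i, T.φi i z * u.wi i z| ≤ ∑ i, |T.φi i z * u.wi i z| := Finset.abs_sum_le_sum_abs _ _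
        _ ≤ ∑ i : Fin n, c0 * (h z * T.φ z) * √(∑ i, u.wi i z ^ 2) := by
          apply Finset.sum_le_sum
          intro i _
          rw [abs_mul]
          apply mul_le_mul (bi i z) _ (abs_nonneg _) (by have := T.nonneg z; have := hh z; positivity)
          apply Real.abs_le_sqrt
          exact Finset.single_le_sum (f := fun j => u.wi j z ^ 2) (fun j _ => sq_nonneg _)
            (Finset.mem_univ i)
        _ = c * (h z * T.φ z * √(∑ i, u.wi i z ^ 2)) := by
          rw [Finset.sum_const, Finset.card_univ, Fintype.card_fin, nsmul_eq_mul, hc]; ring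
    have hΦ := bii z
    have hφt := bt z
    have hS : 0 ≤ ∑ i, u.wi i z ^ 2 := Finset.sum_nonneg fun i _ => sq_nonneg _
    have hφ := T.nonneg z
    have hhz := hh z
    have huz := hu z
    rw [hL]
    generalize (∑ i, T.φi i z * u.wi i z) = Q at hQ ⊢
    generalize (∑ i, T.φii i z) = Φ at hΦ ⊢
    generalize (∑ i, u.wi i z ^ 2) = S at hQ hS ⊢
    generalize T.φ z = φ at *
    generalize T.φt z = φt at *
    generalize h z = k at *
    generalize u.wt z = ut at *
    generalize f (u.w z) = fu at *
    generalize G (u.w z) = Gu at *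
    generalize GG (u.w z) = GGu at *
    generalize F (u.w z) = Fu at *
    generalize ft (u.w z) = ftu at *
    generalize u.w z = uu at *
    generalize E z = Ez at *
    set v := uu + ε with hvd
    set y : ℝ := (ftu * √v * k) ^ (1 / 3 : ℝ) with hy
    have hZ : 0 ≤ ftu * √v * k := by positivity
    have hy0 : 0 ≤ y := by positivity
    have hy3 : y ^ 3 = ftu * √v * k := by
      rw [hy, ← Real.rpow_natCast, ← Real.rpow_mul hZ]; norm_num
    obtain ⟨r, hr, hrv⟩ : ∃ r : ℝ, 0 < r ∧ r ^ 2 = v := ⟨√v, by positivity, Real.sq_sqrt hv.le⟩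
    have hsv : √v = r := by rw [← hrv]; exact Real.sqrt_sq hr.le
    obtain ⟨g, hg, hgS⟩ : ∃ g : ℝ, 0 ≤ g ∧ g ^ 2 = S := ⟨√S, by positivity, Real.sq_sqrt hS⟩
    have hsS : √S = g := by rw [← hgS]; exact Real.sqrt_sq hg
    rw [hsS] at hQ
    rw [hsv] at hy3
    set w : ℝ := g / r with hw
    have hw0 : 0 ≤ w := by positivity
    set s : ℝ := r * k with hs
    have hs0 : 0 ≤ s := by positivity
    have hVS : v⁻¹ * S = w ^ 2 := by rw [hw, ← hrv, ← hgS]; field_simp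
    have hgk : k * g = w * s := by rw [hw, hs]; field_simp
    have hSk : S * k ^ 2 = w ^ 2 * s ^ 2 := by rw [← hgS, hw, hs]; field_simp
    have hfg : ftu * (k * g) = y ^ 3 * w := by rw [hy3, hw]; field_simp
    have hvf : (v * ftu) * k ^ 2 = y ^ 3 * s := by rw [hy3, hs, ← hrv]; ring
    have hs4 : v ^ 2 * k ^ 4 = s ^ 4 := by rw [hs, ← hrv]; ring
    have key := mul_le_mul_of_nonneg_left (HC w s y |ut| hw0 hs0 hy0 (abs_nonneg _)) hφ
    rw [hs4] at hEz
    have hCE := mul_le_mul_of_nonneg_left hEz hC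
    have huv : uu ≤ v := by rw [hvd]; linarith
    have hQ' : |Q| ≤ c * φ * (w * s) := by
      calc |Q| ≤ _ := hQ
        _ = c * φ * (k * g) := by ring
        _ = _ := by rw [hgk]
    have t1 : B * (Gu * Q) ≤ B * (c * φ * (y ^ 3 * w)) := by
      have : Gu * Q ≤ ftu * (c * (k * φ * g)) :=
        calc Gu * Q ≤ Gu * |Q| := by gcongr; exact le_abs_self _
          _ ≤ ftu * (c * (k * φ * g)) := by gcongr
      calc B * (Gu * Q) ≤ B * (ftu * (c * (k * φ * g))) := by gcongr
        _ = B * (c * φ * (ftu * (k * g))) := by ring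
        _ = _ := by rw [hfg]
    have tgen : ∀ X Y : ℝ, 0 ≤ X → X ≤ uu * ftu → |Y| ≤ c0 * (k ^ 2 * φ) →
        |Y * X| ≤ c0 * φ * (y ^ 3 * s) := by
      intro X Y hX hXu hY
      rw [abs_mul, abs_of_nonneg hX]
      calc |Y| * X ≤ c0 * (k ^ 2 * φ) * (v * ftu) := by
            apply mul_le_mul hY (hXu.trans (by gcongr)) hX (by positivity)
        _ = c0 * φ * ((v * ftu) * k ^ 2) := by ring
        _ = _ := by rw [hvf]
    have t2 := tgen GGu φt b4 b5 hφt
    have t3 := tgen Fu φt b6 b7 hφt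
    have t4 := tgen Fu Φ b6 b7 hΦ
    have tS : ∀ Y : ℝ, |Y| ≤ c0 * (k ^ 2 * φ) → |Y * S| ≤ c0 * φ * (w ^ 2 * s ^ 2) := by
      intro Y hY
      rw [abs_mul, abs_of_nonneg hS]
      calc |Y| * S ≤ c0 * (k ^ 2 * φ) * S := by gcongr
        _ = c0 * φ * (S * k ^ 2) := by ring
        _ = _ := by rw [hSk]
    have t5 := tS φt hφt
    have t6 := tS Φ hΦ
    have t7 : |ut * Q| ≤ c * φ * (|ut| * (w * s)) := by
      rw [abs_mul]
      calc |ut| * |Q| ≤ |ut| * (c * φ * (w * s)) := by gcongr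
        _ = _ := by ring
    have t8 : a * (v⁻¹ * S * Q) ≤ a * (c * φ * (w ^ 3 * s)) := by
      rw [hVS]
      have : w ^ 2 * Q ≤ w ^ 2 * (c * φ * (w * s)) := by
        gcongr; exact (le_abs_self _).trans hQ'
      calc a * (w ^ 2 * Q) ≤ a * (w ^ 2 * (c * φ * (w * s))) := by gcongr
        _ = _ := by ring
    have t9 : φ * B * (v⁻¹ * S * ut) ≤ φ * B * (w ^ 2 * |ut|) := by
      rw [hVS]; gcongr; exact le_abs_self _
    have t10 : (v⁻¹) ^ 2 * S ^ 2 = w ^ 4 := by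
      rw [← mul_pow, hVS]; ring
    have t11 : |ut| ^ 2 = ut ^ 2 := sq_abs _
    have u2 := mul_le_mul_of_nonneg_left ((neg_abs_le _).trans' (neg_le_neg t2)) hB0
    have u3 := mul_le_mul_of_nonneg_left ((le_abs_self _).trans t3) hγ0
    have u3' := mul_le_mul_of_nonneg_left ((neg_abs_le _).trans' (neg_le_neg t3)) hM0
    have u4 := (le_abs_self _).trans t4
    have u5 := mul_le_mul_of_nonneg_left ((le_abs_self _).trans t5) (by positivity : 0 ≤ (γ + M) / 2)
    have u6 := (le_abs_self _).trans t6
    have u7 := mul_le_mul_of_nonneg_left ((neg_abs_le _).trans' (neg_le_neg t7))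
      (by positivity : 0 ≤ γ + M)
    have u7' := (le_abs_self _).trans t7
    have e1 : (-a) ^ 2 * γ + -a = -A := by rw [hAd]; ring
    rw [t11] at key
    have eB : ((n:ℝ) + 2) / n = B / a := by rw [hB]; field_simp
    rw [eB]
    have e2 : -a * (B / a) = -B := by field_simp
    rw [e1, e2]
    have t10' : φ * A * ((v⁻¹) ^ 2 * S ^ 2) = φ * A * w ^ 4 := by rw [t10]
    rw [← hM] at key
    linarith)
  have hR : ∫ z, ((fun z => C * E z) - fun z => T.φ z * (B * (G (u.w z) * f (u.w z)) - γ * f (u.w z) ^ 2)) z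
      = C * (∫ z, E z) - ∫ z, T.φ z * (B * (G (u.w z) * f (u.w z)) - γ * f (u.w z) ^ 2) := by
    simp only [Pi.sub_apply]
    rw [integral_sub (iE.const_mul C) iL, integral_const_mul]
  rw [hR] at hle
  have : 0 ≤ C * (∫ z, E z) - ∫ z, T.φ z * (B * (G (u.w z) * f (u.w z)) - γ * f (u.w z) ^ 2) :=
    hP.trans hle
  linarith

theorem hasDerivAt_posPow (k : ℕ) (x : ℝ) :
    HasDerivAt (fun x : ℝ => (max 0 x) ^ (k + 2)) (((k : ℝ) + 2) * (max 0 x) ^ (k + 1)) x := by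
  rcases lt_trichotomy x 0 with h | h | h
  · have : (fun x : ℝ => (max 0 x) ^ (k + 2)) =ᶠ[nhds x] fun _ => 0 := by
      filter_upwards [Iio_mem_nhds h] with y hy
      simp [max_eq_left (le_of_lt (mem_Iio.1 hy))]
    rw [max_eq_left h.le]
    simpa using (hasDerivAt_const x (0:ℝ)).congr_of_eventuallyEq this
  · subst h
    simp only [max_self, ne_eq, Nat.add_eq_zero_iff, one_ne_zero, and_false, not_false_eq_true,
      zero_pow, mul_zero]
    rw [hasDerivAt_iff_isLittleO_nhds_zero]
    simp only [zero_add, max_self, ne_eq, Nat.add_eq_zero_iff, OfNat.ofNat_ne_zero, and_false,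
      not_false_eq_true, zero_pow, sub_zero, smul_zero]
    have h1 : (fun h : ℝ => (max 0 h) ^ (k + 2)) =O[nhds 0] fun h : ℝ => h ^ (k + 2) := by
      apply Asymptotics.IsBigO.of_bound 1
      filter_upwards with y
      rw [one_mul, norm_pow, norm_pow]
      apply pow_le_pow_left₀ (norm_nonneg _)
      rw [Real.norm_eq_abs, Real.norm_eq_abs, abs_of_nonneg (le_max_left _ _)]
      exact max_le (abs_nonneg _) (le_abs_self _)
    exact h1.trans_isLittleO (by
      simpa using Asymptotics.isLittleO_pow_id (𝕜 := ℝ) (n := k + 2) (by omega))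
  · have : (fun x : ℝ => (max 0 x) ^ (k + 2)) =ᶠ[nhds x] fun x => x ^ (k + 2) := by
      filter_upwards [Ioi_mem_nhds h] with y hy
      simp [max_eq_right (le_of_lt (mem_Ioi.1 hy))]
    rw [max_eq_right h.le]
    have := (hasDerivAt_pow (k + 2) x).congr_of_eventuallyEq this
    simpa using this

/-- the quadratic form of the cutoff -/
noncomputable def qf {n : ℕ} (R : ℝ) (z : XT n) : ℝ :=
  1 - (∑ i, z.1 i ^ 2) / R ^ 2 - z.2 ^ 2 / R ^ 4

noncomputable def eta {n : ℕ} (R : ℝ) (z : XT n) : ℝ := max 0 (qf R z)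

theorem qf_cont {n : ℕ} (R : ℝ) : Continuous (qf (n := n) R) := by
  unfold qf; fun_prop

theorem eta_cont {n : ℕ} (R : ℝ) : Continuous (eta (n := n) R) :=
  continuous_const.max (qf_cont R)

theorem eta_nonneg {n : ℕ} (R : ℝ) (z : XT n) : 0 ≤ eta R z := le_max_left _ _

theorem eta_le_one {n : ℕ} (R : ℝ) (z : XT n) : eta R z ≤ 1 := by
  have h1 : 0 ≤ (∑ i, z.1 i ^ 2) / R ^ 2 := by positivity
  have h2 : 0 ≤ z.2 ^ 2 / R ^ 4 := by positivity
  refine max_le (by norm_num) ?_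
  unfold qf; linarith

theorem eta_mono {n : ℕ} {R R' : ℝ} (hR : 0 < R) (h : R ≤ R') (z : XT n) :
    eta R z ≤ eta R' z := by
  unfold eta qf
  gcongr

theorem eta_pos_bd {n : ℕ} {R : ℝ} (hR : 0 < R) {z : XT n} (hz : eta R z ≠ 0) :
    (∀ i, |z.1 i| ≤ R) ∧ |z.2| ≤ R ^ 2 := by
  have hq : 0 < qf R z := by
    by_contra h
    exact hz (max_eq_left (not_lt.1 h))
  have h1 : 0 ≤ (∑ i, z.1 i ^ 2) / R ^ 2 := by positivity
  have h2 : 0 ≤ z.2 ^ 2 / R ^ 4 := by positivity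
  unfold qf at hq
  constructor
  · intro i
    have h3 : (∑ i, z.1 i ^ 2) / R ^ 2 ≤ 1 := by linarith
    rw [div_le_one (by positivity)] at h3
    have h4 : z.1 i ^ 2 ≤ ∑ i, z.1 i ^ 2 :=
      Finset.single_le_sum (f := fun i => z.1 i ^ 2) (fun i _ => sq_nonneg _) (Finset.mem_univ i)
    exact abs_le_of_sq_le_sq (h4.trans h3) hR.le
  · have h3 : z.2 ^ 2 / R ^ 4 ≤ 1 := by linarith
    rw [div_le_one (by positivity)] at h3
    exact abs_le_of_sq_le_sq (by nlinarith) (by positivity)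

/-- box containing the support -/
def Box (n : ℕ) (R : ℝ) : Set (XT n) :=
  (Icc (fun _ => -R) (fun _ => R)) ×ˢ (Icc (-R ^ 2) (R ^ 2))

theorem eta_off {n : ℕ} {R : ℝ} (hR : 0 < R) {z : XT n} (hz : z ∉ Box n R) : eta R z = 0 := by
  by_contra h
  obtain ⟨h1, h2⟩ := eta_pos_bd hR h
  apply hz
  refine ⟨⟨fun i => (abs_le.1 (h1 i)).1, fun i => (abs_le.1 (h1 i)).2⟩, abs_le.1 h2⟩

theorem Box_compact (n : ℕ) (R : ℝ) : IsCompact (Box n R) := isCompact_Icc.prod isCompact_Icc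

theorem Box_vol (n : ℕ) {R : ℝ} (hR : 0 < R) :
    (volume : Measure (XT n)).real (Box n R) = (2 * R) ^ n * (2 * R ^ 2) := by
  unfold Box
  rw [Measure.volume_eq_prod, measureReal_def, Measure.prod_prod, ENNReal.toReal_mul]
  rw [Real.volume_Icc_pi_toReal (by intro i; simp; linarith), Real.volume_Icc,
    ENNReal.toReal_ofReal (by nlinarith)]
  simp
  ring

theorem qf_ldt {n : ℕ} (R : ℝ) : LD (qf (n := n) R) (fun z => -(2 * z.2 / R ^ 4)) eT := by
  intro z
  unfold qf eT
  simp only [Prod.fst_add, Prod.smul_fst, smul_zero, add_zero, Prod.snd_add, Prod.smul_snd, smul_eq_mul, mul_one]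
  have : HasDerivAt (fun s : ℝ => z.2 + s) 1 0 := by simpa using (hasDerivAt_id (0:ℝ)).const_add z.2
  have h2 := ((this.pow 2).div_const (R ^ 4)).const_sub (1 - (∑ i, z.1 i ^ 2) / R ^ 2)
  refine h2.congr_deriv ?_
  simp

theorem coord_ld {n : ℕ} (i j : Fin n) :
    LD (fun z : XT n => z.1 j) (fun _ => if j = i then 1 else 0) (eX i) := by
  intro z
  unfold eX
  simp only [Prod.fst_add, Prod.smul_fst, Pi.add_apply, Pi.smul_apply, smul_eq_mul, Pi.single_apply]
  simpa using ((hasDerivAt_id (0:ℝ)).mul_const (if j = i then (1:ℝ) else 0)).const_add (z.1 j)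

theorem qf_ldi {n : ℕ} (R : ℝ) (i : Fin n) :
    LD (qf (n := n) R) (fun z => -(2 * z.1 i / R ^ 2)) (eX i) := by
  intro z
  have h1 : ∀ j, HasDerivAt (fun s : ℝ => (z + s • eX i).1 j ^ 2)
      (2 * z.1 j * (if j = i then 1 else 0)) 0 := by
    intro j
    have := (coord_ld i j z).pow 2
    refine this.congr_deriv ?_
    simp
  have h2 := HasDerivAt.fun_sum (u := Finset.univ) (fun j _ => h1 j)
  have h3 := ((h2.div_const (R ^ 2)).const_sub 1).sub_const (z.2 ^ 2 / R ^ 4)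
  have h4 : (fun s : ℝ => qf R (z + s • eX i)) = fun s : ℝ =>
      1 - (∑ j, (z + s • eX i).1 j ^ 2) / R ^ 2 - z.2 ^ 2 / R ^ 4 := by
    funext s; simp [qf, eX]
  rw [h4]
  refine h3.congr_deriv ?_
  simp

theorem etapow_ld {n : ℕ} (R : ℝ) (k : ℕ) {e : XT n} {q' : XT n → ℝ} (h : LD (qf R) q' e) :
    LD (fun z => eta R z ^ (k + 2)) (fun z => ((k : ℝ) + 2) * eta R z ^ (k + 1) * q' z) e :=
  h.comp (G := fun x : ℝ => (max 0 x) ^ (k + 2))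
    (G' := fun x => ((k : ℝ) + 2) * (max 0 x) ^ (k + 1)) (fun z => hasDerivAt_posPow k _)

/-- cutoff `eta^(k+4)` -/
noncomputable def cutT (n : ℕ) (k : ℕ) (R : ℝ) (hR : 0 < R) : TestFn n where
  φ z := eta R z ^ (k + 4)
  φt z := (((k + 2 : ℕ) : ℝ) + 2) * eta R z ^ (k + 3) * (-(2 * z.2 / R ^ 4))
  φi i z := (((k + 2 : ℕ) : ℝ) + 2) * eta R z ^ (k + 3) * (-(2 * z.1 i / R ^ 2))
  φii i z := ((((k + 2 : ℕ) : ℝ) + 2) * ((((k + 1 : ℕ) : ℝ) + 2) * eta R z ^ (k + 2) *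
      (-(2 * z.1 i / R ^ 2)))) * (-(2 * z.1 i / R ^ 2)) +
      (((k + 2 : ℕ) : ℝ) + 2) * eta R z ^ (k + 3) * (-(2 / R ^ 2))
  nonneg z := pow_nonneg (eta_nonneg R z) _
  cpt := HasCompactSupport.intro (Box_compact n R) (fun z hz => by simp [eta_off hR hz])
  cont := (eta_cont R).pow _
  contt := by have := eta_cont (n := n) R; fun_prop
  conti i := by have := eta_cont (n := n) R; fun_prop
  contii i := by have := eta_cont (n := n) R; fun_prop
  ldt := etapow_ld R (k + 2) (qf_ldt R)
  ldi i := etapow_ld R (k + 2) (qf_ldi R i)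
  ldii i := by
    have h1 : LD (fun z : XT n => (((k + 2 : ℕ) : ℝ) + 2) * eta R z ^ (k + 3)) _ (eX i) :=
      LD.comp (etapow_ld R (k + 1) (qf_ldi R i)) (G := fun x => (((k + 2 : ℕ) : ℝ) + 2) * x)
        (G' := fun _ => (((k + 2 : ℕ) : ℝ) + 2)) (fun z => by
          simpa using (hasDerivAt_id _).const_mul (((k + 2 : ℕ) : ℝ) + 2))
    have h2 : LD (fun z : XT n => (-(2 * z.1 i / R ^ 2))) _ (eX i) :=
      LD.comp (coord_ld i i) (G := fun x => (-(2 * x / R ^ 2))) (G' := fun _ => -(2 / R ^ 2))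
        (fun z => by
          simpa using ((((hasDerivAt_id (z.1 i)).const_mul 2)).div_const (R ^ 2)).fun_neg)
    refine (h1.mul h2).congr (fun z => ?_)
    simp

noncomputable def hh {n : ℕ} (R : ℝ) (z : XT n) : ℝ := (R * eta R z)⁻¹

theorem hh_nonneg {n : ℕ} {R : ℝ} (hR : 0 < R) (z : XT n) : 0 ≤ hh R z :=
  inv_nonneg.2 (mul_nonneg hR.le (eta_nonneg R z))

theorem cutT_bounds (n k : ℕ) : ∃ c0 : ℝ, 0 ≤ c0 ∧ ∀ (R : ℝ) (hR : 0 < R),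
    (∀ i z, |(cutT n k R hR).φi i z| ≤ c0 * (hh R z * (cutT n k R hR).φ z)) ∧
    (∀ z, |∑ i, (cutT n k R hR).φii i z| ≤ c0 * (hh R z ^ 2 * (cutT n k R hR).φ z)) ∧
    (∀ z, |(cutT n k R hR).φt z| ≤ c0 * (hh R z ^ 2 * (cutT n k R hR).φ z)) := by
  set M : ℝ := ((k + 2 : ℕ) : ℝ) + 2 with hM
  have hM0 : 0 ≤ M := by positivity
  set M' : ℝ := ((k + 1 : ℕ) : ℝ) + 2 with hM'
  have hM'0 : 0 ≤ M' := by positivity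
  refine ⟨2 * M + n * (4 * (M * M') + 2 * M), by positivity, fun R hR => ?_⟩
  have key : ∀ z : XT n, eta R z ≠ 0 → hh R z * eta R z ^ (k + 4) = eta R z ^ (k + 3) / R ∧
      hh R z ^ 2 * eta R z ^ (k + 4) = eta R z ^ (k + 2) / R ^ 2 := by
    intro z hz
    unfold hh
    constructor <;> field_simp <;> ring
  refine ⟨fun i z => ?_, fun z => ?_, fun z => ?_⟩
  · by_cases hz : eta R z = 0
    · simp [cutT, hz]
    obtain ⟨k1, k2⟩ := key z hz
    have e0 := eta_nonneg R z
    simp only [cutT]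
    rw [k1, ← hM]
    have h1 := (eta_pos_bd hR hz).1 i
    have : |M * eta R z ^ (k + 3) * -(2 * z.1 i / R ^ 2)| = M * eta R z ^ (k + 3) * (2 * |z.1 i| / R ^ 2) := by
      rw [abs_mul, abs_of_nonneg (by positivity : 0 ≤ M * eta R z ^ (k + 3)), abs_neg, abs_div, abs_mul]
      simp
    rw [this]
    calc _ ≤ M * eta R z ^ (k + 3) * (2 * R / R ^ 2) := by gcongr
      _ = 2 * M * (eta R z ^ (k + 3) / R) := by field_simp
      _ ≤ _ := by
        gcongr
        have : 0 ≤ n * (4 * (M * M') + 2 * M) := by positivity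
        linarith
  · by_cases hz : eta R z = 0
    · simp [cutT, hz]
    obtain ⟨k1, k2⟩ := key z hz
    have e0 := eta_nonneg R z
    have e1 := eta_le_one R z
    simp only [cutT]
    rw [k2, ← hM, ← hM']
    refine (Finset.abs_sum_le_sum_abs _ _).trans ?_
    have hi : ∀ i : Fin n, |M * (M' * eta R z ^ (k + 2) * -(2 * z.1 i / R ^ 2)) * -(2 * z.1 i / R ^ 2) +
        M * eta R z ^ (k + 3) * -(2 / R ^ 2)| ≤ (4 * (M * M') + 2 * M) * (eta R z ^ (k + 2) / R ^ 2) := by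
      intro i
      have h1 := (eta_pos_bd hR hz).1 i
      have h2 : z.1 i ^ 2 ≤ R ^ 2 := by
        rw [← sq_abs]; gcongr
      have h3 : eta R z ^ (k + 3) ≤ eta R z ^ (k + 2) := pow_le_pow_of_le_one e0 e1 (by omega)
      refine (abs_add_le _ _).trans ?_
      have a1 : |M * (M' * eta R z ^ (k + 2) * -(2 * z.1 i / R ^ 2)) * -(2 * z.1 i / R ^ 2)|
          ≤ 4 * (M * M') * (eta R z ^ (k + 2) / R ^ 2) := by
        have : M * (M' * eta R z ^ (k + 2) * -(2 * z.1 i / R ^ 2)) * -(2 * z.1 i / R ^ 2)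
          = 4 * (M * M') * (eta R z ^ (k + 2) / R ^ 4) * z.1 i ^ 2 := by field_simp; ring
        rw [this, abs_of_nonneg (by positivity)]
        calc _ ≤ 4 * (M * M') * (eta R z ^ (k + 2) / R ^ 4) * R ^ 2 := by gcongr
          _ = _ := by field_simp
      have a2 : |M * eta R z ^ (k + 3) * -(2 / R ^ 2)| ≤ 2 * M * (eta R z ^ (k + 2) / R ^ 2) := by
        rw [abs_mul, abs_neg, abs_of_nonneg (by positivity), abs_of_nonneg (by positivity)]
        calc _ ≤ M * eta R z ^ (k + 2) * (2 / R ^ 2) := by gcongr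
          _ = _ := by ring
      linarith
    refine (Finset.sum_le_sum (fun i _ => hi i)).trans ?_
    simp only [Finset.sum_const, Finset.card_univ, Fintype.card_fin, nsmul_eq_mul]
    have : 0 ≤ 2 * M * (eta R z ^ (k + 2) / R ^ 2) := by positivity
    linarith
  · by_cases hz : eta R z = 0
    · simp [cutT, hz]
    obtain ⟨k1, k2⟩ := key z hz
    have e0 := eta_nonneg R z
    have e1 := eta_le_one R z
    have h3 : eta R z ^ (k + 3) ≤ eta R z ^ (k + 2) := pow_le_pow_of_le_one e0 e1 (by omega)
    simp only [cutT]
    rw [k2, ← hM]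
    have h1 := (eta_pos_bd hR hz).2
    have : |M * eta R z ^ (k + 3) * -(2 * z.2 / R ^ 4)| = M * eta R z ^ (k + 3) * (2 * |z.2| / R ^ 4) := by
      rw [abs_mul, abs_of_nonneg (by positivity : 0 ≤ M * eta R z ^ (k + 3)), abs_neg, abs_div, abs_mul]
      simp [abs_of_pos hR]
    rw [this]
    calc _ ≤ M * eta R z ^ (k + 2) * (2 * R ^ 2 / R ^ 4) := by gcongr
      _ = 2 * M * (eta R z ^ (k + 2) / R ^ 2) := by field_simp
      _ ≤ _ := by
        gcongr
        have : 0 ≤ n * (4 * (M * M') + 2 * M) := by positivity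
        linarith

noncomputable def f0 (f : ℝ → ℝ) (y : ℝ) : ℝ := f (max y 0)
noncomputable def gI (f : ℝ → ℝ) : ℝ → ℝ := indicator (Ioi 0) (fun z => f z / z)
noncomputable def Geps (f : ℝ → ℝ) (ε y : ℝ) : ℝ := ∫ z in (0:ℝ)..y, f0 f z * (|z| + ε)⁻¹
noncomputable def GGeps (f : ℝ → ℝ) (ε y : ℝ) : ℝ := ∫ z in (0:ℝ)..y, Geps f ε z
noncomputable def Fp (f : ℝ → ℝ) (y : ℝ) : ℝ := ∫ z in (0:ℝ)..y, f0 f z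

structure FH (f : ℝ → ℝ) : Prop where
  cont : ContinuousOn f (Ici 0)
  pos : ∀ s : ℝ, 0 < s → 0 < f s
  int : IntegrableOn (fun z : ℝ => f z / z) (Ioc (0 : ℝ) 1)

namespace FH
variable {f : ℝ → ℝ}

theorem f0_of_nonneg {y : ℝ} (hy : 0 ≤ y) : f0 f y = f y := by simp [f0, hy]

theorem f0_cont (H : FH f) : Continuous (f0 f) := by
  unfold f0
  exact H.cont.comp_continuous (by fun_prop) (fun y => mem_Ici.2 (le_max_right _ _))

theorem f_nonneg (H : FH f) {y : ℝ} (hy : 0 ≤ y) : 0 ≤ f y := by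
  rcases hy.eq_or_lt with rfl | h
  · have h1 : Tendsto f (nhdsWithin 0 (Ioi 0)) (nhds (f 0)) :=
      (H.cont 0 (by simp)).mono_left (nhdsWithin_mono _ Ioi_subset_Ici_self)
    exact ge_of_tendsto h1 (eventually_nhdsWithin_of_forall fun s hs => (H.pos s hs).le)
  · exact (H.pos y h).le

theorem f0_nonneg (H : FH f) (y : ℝ) : 0 ≤ f0 f y := H.f_nonneg (le_max_right _ _)

theorem gI_nonneg (H : FH f) (y : ℝ) : 0 ≤ gI f y :=
  indicator_nonneg (fun z hz => div_nonneg (H.pos z hz).le (le_of_lt hz)) y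

theorem div_cont (H : FH f) : ContinuousOn (fun z => f z / z) (Ioi 0) :=
  (H.cont.mono Ioi_subset_Ici_self).div continuousOn_id (fun z hz => ne_of_gt hz)

theorem int_Ioc (H : FH f) (s : ℝ) : IntegrableOn (fun z : ℝ => f z / z) (Ioc (0 : ℝ) s) := by
  have h1 : IntegrableOn (fun z : ℝ => f z / z) (Icc 1 s) :=
    (H.div_cont.mono (fun z hz => lt_of_lt_of_le one_pos hz.1)).integrableOn_Icc
  refine (H.int.union h1).mono_set (fun z hz => ?_)
  rcases le_total z 1 with h | h
  · exact Or.inl ⟨hz.1, h⟩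
  · exact Or.inr ⟨h, hz.2⟩

theorem gI_int (H : FH f) (a b : ℝ) : IntervalIntegrable (gI f) volume a b := by
  have h : ∀ a b, IntegrableOn (gI f) (Ioc a b) := by
    intro a b
    unfold gI
    rw [IntegrableOn, integrable_indicator_iff measurableSet_Ioi, IntegrableOn,
      Measure.restrict_restrict measurableSet_Ioi]
    exact (H.int_Ioc b).mono_set (fun z hz => ⟨hz.1, hz.2.2⟩)
  exact ⟨h a b, h b a⟩

theorem ft_eq (y : ℝ) : fTilde f y = ∫ z in (0:ℝ)..y, gI f z := by
  unfold fTilde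
  rcases le_total 0 y with h | h
  · rw [intervalIntegral.integral_of_le h]
    refine setIntegral_congr_fun measurableSet_Ioc (fun z hz => ?_)
    simp [gI, hz.1]
  · rw [intervalIntegral.integral_of_ge h, Ioc_eq_empty (by simpa using h)]
    have : ∫ z in Ioc y 0, gI f z = ∫ z in Ioc y 0, (0:ℝ) :=
      setIntegral_congr_fun measurableSet_Ioc (fun z hz => by simp [gI, hz.2])
    rw [this]; simp

theorem ft_cont (H : FH f) : Continuous (fTilde f) := by
  have : fTilde f = fun y => ∫ z in (0:ℝ)..y, gI f z := funext ft_eq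
  rw [this]
  exact intervalIntegral.continuous_primitive H.gI_int 0

theorem ft_mono (H : FH f) : Monotone (fTilde f) := by
  intro a b hab
  rw [ft_eq, ft_eq, ← sub_nonneg, intervalIntegral.integral_interval_sub_left (H.gI_int _ _) (H.gI_int _ _)]
  exact intervalIntegral.integral_nonneg hab (fun z _ => H.gI_nonneg z)

theorem ft_zero : fTilde f 0 = 0 := by simp [fTilde]

theorem ft_nonneg (H : FH f) {y : ℝ} (hy : 0 ≤ y) : 0 ≤ fTilde f y := by
  rw [← ft_zero (f := f)]; exact H.ft_mono hy

theorem ft_deriv (H : FH f) {s : ℝ} (hs : 0 < s) : HasDerivAt (fTilde f) (f s / s) s := by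
  have : fTilde f = fun y => ∫ z in (0:ℝ)..y, gI f z := funext ft_eq
  rw [this]
  have hc : ContinuousOn (gI f) (Ioi 0) :=
    H.div_cont.congr (fun z hz => by simp only [gI]; rw [indicator_of_mem hz])
  have h := intervalIntegral.integral_hasDerivAt_right (H.gI_int 0 s)
    (hc.stronglyMeasurableAtFilter isOpen_Ioi s hs) (hc.continuousAt (Ioi_mem_nhds hs))
  refine h.congr_deriv ?_
  simp only [gI]; rw [indicator_of_mem (by exact hs)]

theorem ft_pos (H : FH f) {s : ℝ} (hs : 0 < s) : 0 < fTilde f s := by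
  rw [ft_eq]
  refine intervalIntegral.intervalIntegral_pos_of_pos_on (H.gI_int 0 s) (fun z hz => ?_) hs
  simp only [gI]; rw [indicator_of_mem (by exact hz.1)]
  exact div_pos (H.pos z hz.1) hz.1

theorem G_int_cont (H : FH f) {ε : ℝ} (hε : 0 < ε) : Continuous (fun z => f0 f z * (|z| + ε)⁻¹) := by
  refine H.f0_cont.mul (Continuous.inv₀ (by fun_prop) (fun z => ?_))
  positivity

theorem G_deriv (H : FH f) {ε : ℝ} (hε : 0 < ε) (y : ℝ) : HasDerivAt (Geps f ε) (f0 f y * (|y| + ε)⁻¹) y :=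
  ((H.G_int_cont hε).integral_hasStrictDerivAt 0 y).hasDerivAt

theorem G_cont (H : FH f) {ε : ℝ} (hε : 0 < ε) : Continuous (Geps f ε) :=
  continuous_iff_continuousAt.2 (fun y => (H.G_deriv hε y).continuousAt)

theorem GG_deriv (H : FH f) {ε : ℝ} (hε : 0 < ε) (y : ℝ) : HasDerivAt (GGeps f ε) (Geps f ε y) y :=
  ((H.G_cont hε).integral_hasStrictDerivAt 0 y).hasDerivAt

theorem F_deriv (H : FH f) (y : ℝ) : HasDerivAt (Fp f) (f0 f y) y :=
  (H.f0_cont.integral_hasStrictDerivAt 0 y).hasDerivAt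

theorem G_nonneg (H : FH f) {ε : ℝ} (hε : 0 < ε) {y : ℝ} (hy : 0 ≤ y) : 0 ≤ Geps f ε y :=
  intervalIntegral.integral_nonneg hy (fun z _ => by have := H.f0_nonneg z; positivity)

theorem gI_ge (H : FH f) {ε : ℝ} (hε : 0 ≤ ε) {z : ℝ} (hz : 0 < z) : f0 f z * (|z| + ε)⁻¹ ≤ gI f z := by
  simp only [gI]; rw [indicator_of_mem (by exact hz), f0_of_nonneg hz.le, abs_of_pos hz, ← div_eq_mul_inv]
  have := H.pos z hz
  gcongr
  linarith

theorem G_le (H : FH f) {ε : ℝ} (hε : 0 < ε) {y : ℝ} (hy : 0 ≤ y) : Geps f ε y ≤ fTilde f y := by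
  rw [ft_eq]
  exact intervalIntegral.integral_mono_on_of_le_Ioo hy ((H.G_int_cont hε).intervalIntegrable _ _)
    (H.gI_int _ _) (fun z hz => H.gI_ge hε.le hz.1)

theorem fun_bounds (H : FH f) {ε : ℝ} (hε : 0 < ε) (y : ℝ) (hy : 0 ≤ y) :
    0 ≤ fTilde f y ∧ 0 ≤ Geps f ε y ∧ Geps f ε y ≤ fTilde f y ∧ 0 ≤ GGeps f ε y ∧
      GGeps f ε y ≤ y * fTilde f y ∧ 0 ≤ Fp f y ∧ Fp f y ≤ y * fTilde f y := by
  refine ⟨H.ft_nonneg hy, H.G_nonneg hε hy, H.G_le hε hy, ?_, ?_, ?_, ?_⟩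
  · exact intervalIntegral.integral_nonneg hy (fun z hz => H.G_nonneg hε hz.1)
  · have h : ∫ z in (0:ℝ)..y, fTilde f y = y * fTilde f y := by simp
    rw [← h]
    refine intervalIntegral.integral_mono_on hy ((H.G_cont hε).intervalIntegrable _ _)
      (by simp) (fun z hz => (H.G_le hε hz.1).trans (H.ft_mono hz.2))
  · exact intervalIntegral.integral_nonneg hy (fun z hz => H.f0_nonneg z)
  · rw [ft_eq, ← intervalIntegral.integral_const_mul]
    refine intervalIntegral.integral_mono_on_of_le_Ioo hy (H.f0_cont.intervalIntegrable _ _)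
      ((H.gI_int _ _).const_mul _) (fun z hz => ?_)
    simp only [gI]; rw [indicator_of_mem (by exact hz.1), f0_of_nonneg hz.1.le]
    have := H.pos z hz.1
    have hz0 := hz.1
    calc f z = z * (f z / z) := by field_simp
      _ ≤ y * (f z / z) := by gcongr; exact hz.2.le

theorem G_tendsto (H : FH f) {y : ℝ} (hy : 0 ≤ y) :
    Tendsto (fun k : ℕ => Geps f (1 / ((k : ℝ) + 1)) y) atTop (nhds (fTilde f y)) := by
  rw [ft_eq]
  have hp : ∀ k : ℕ, 0 < 1 / ((k : ℝ) + 1) := fun k => by positivity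
  refine intervalIntegral.tendsto_integral_filter_of_dominated_convergence (gI f)
    (Eventually.of_forall fun k => (H.G_int_cont (hp k)).aestronglyMeasurable)
    (Eventually.of_forall fun k => ae_of_all _ fun z hz => ?_) (H.gI_int _ _)
    (ae_of_all _ fun z hz => ?_)
  · rw [uIoc_of_le hy] at hz
    rw [Real.norm_eq_abs, abs_of_nonneg (by have := H.f0_nonneg z; have := hp k; positivity)]
    exact H.gI_ge (hp k).le hz.1
  · rw [uIoc_of_le hy] at hz
    have : gI f z = f0 f z * (|z| + 0)⁻¹ := by
      simp only [gI]; rw [indicator_of_mem (by exact hz.1), f0_of_nonneg hz.1.le, abs_of_pos hz.1, add_zero, div_eq_mul_inv]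
    rw [this]
    refine Tendsto.const_mul _ (Tendsto.inv₀ (tendsto_const_nhds.add tendsto_one_div_add_atTop_nhds_zero_nat) ?_)
    have := hz.1
    positivity

theorem f_zero_le (H : FH f) {p : ℝ} (h : ∀ s : ℝ, 0 < s → f s ≤ p * fTilde f s) : f 0 ≤ 0 := by
  have h1 : Tendsto f (nhdsWithin 0 (Ioi 0)) (nhds (f 0)) :=
      (H.cont 0 (by simp)).mono_left (nhdsWithin_mono _ Ioi_subset_Ici_self)
  have h2 : Tendsto (fun s => p * fTilde f s) (nhdsWithin 0 (Ioi 0)) (nhds (p * fTilde f 0)) :=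
    ((H.ft_cont.tendsto 0).mono_left nhdsWithin_le_nhds).const_mul p
  rw [ft_zero, mul_zero] at h2
  exact le_of_tendsto_of_tendsto h1 h2 (eventually_nhdsWithin_of_forall fun s hs => h s hs)
end FH

noncomputable def regOf {n : ℕ} {f : ℝ → ℝ} {u : (Fin n → ℝ) → ℝ → ℝ}
    (h : IsEntireParabolicSol f u) : Reg n where
  w z := u z.1 z.2
  wt z := deriv (u z.1) z.2
  wi i z := deriv (fun s : ℝ => u (Function.update z.1 i s) z.2) (z.1 i)
  wii i z := deriv (deriv (fun s : ℝ => u (Function.update z.1 i s) z.2)) (z.1 i)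
  cont := h.1
  contt := h.2.2.1
  conti := h.2.2.2.2.1
  contii := h.2.2.2.2.2.2.1
  ldt z := by
    have h1 := (h.2.1 z.1 z.2).hasDerivAt
    have h2 : HasDerivAt (fun s : ℝ => z.2 + s) 1 0 := by
      simpa using (hasDerivAt_id (0:ℝ)).const_add z.2
    have h3 := HasDerivAt.comp (h₂ := u z.1) (h₂' := deriv (u z.1) z.2) (0:ℝ) (by simpa using h1) h2
    simpa [eT, Function.comp_def] using h3
  ldi i z := by
    have h1 := (h.2.2.2.1 z.1 z.2 i).hasDerivAt
    have h2 : HasDerivAt (fun s : ℝ => z.1 i + s) 1 0 := by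
      simpa using (hasDerivAt_id (0:ℝ)).const_add (z.1 i)
    have h3 := HasDerivAt.comp (h₂ := fun s : ℝ => u (Function.update z.1 i s) z.2)
      (h₂' := deriv (fun s : ℝ => u (Function.update z.1 i s) z.2) (z.1 i)) (0:ℝ) (by simpa using h1) h2
    have h4 : ∀ s : ℝ, (z + s • eX i).1 = Function.update z.1 i (z.1 i + s) := by
      intro s; ext j
      by_cases hj : j = i
      · subst hj; simp [eX]
      · simp [eX, hj]
    have h5 : ∀ s : ℝ, (z + s • eX i).2 = z.2 := by intro s; simp [eX]
    simp only [h4, h5]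
    simpa [Function.comp_def] using h3
  ldii i z := by
    have h1 := (h.2.2.2.2.2.1 z.1 z.2 i).hasDerivAt
    have h2 : HasDerivAt (fun s : ℝ => z.1 i + s) 1 0 := by
      simpa using (hasDerivAt_id (0:ℝ)).const_add (z.1 i)
    have h3 := HasDerivAt.comp (h₂ := deriv fun s : ℝ => u (Function.update z.1 i s) z.2)
      (h₂' := deriv (deriv (fun s : ℝ => u (Function.update z.1 i s) z.2)) (z.1 i)) (0:ℝ) (by simpa using h1) h2
    have h4 : ∀ s : ℝ, (z + s • eX i).1 = Function.update z.1 i (z.1 i + s) := by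
      intro s; ext j
      by_cases hj : j = i
      · subst hj; simp [eX]
      · simp [eX, hj]
    have h5 : ∀ s : ℝ, (z + s • eX i).2 = z.2 := by intro s; simp [eX]
    simp only [h4, h5]
    simpa [Function.comp_def] using h3

noncomputable def EE {n : ℕ} (k : ℕ) (R : ℝ) (ft : ℝ → ℝ) (w : XT n → ℝ) (ε : ℝ) (z : XT n) : ℝ :=
  eta R z ^ (k + 4) * ((w z + ε) ^ 2 * hh R z ^ 4 +
        ((ft (w z) * √(w z + ε) * hh R z) ^ (1 / 3 : ℝ)) ^ 4)

theorem EE_eq {n : ℕ} {k : ℕ} (hk : 1 ≤ k) {R : ℝ} (hR : 0 < R) {ft : ℝ → ℝ} {w : XT n → ℝ}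
    (hft : ∀ z, 0 ≤ ft (w z)) (ε : ℝ) (z : XT n) :
    EE k R ft w ε z = eta R z ^ k * ((w z + ε) ^ 2 / R ^ 4 +
      ((ft (w z) * √(w z + ε) * eta R z ^ 2 / R) ^ (1 / 3 : ℝ)) ^ 4) := by
  unfold EE
  by_cases hz : eta R z = 0
  · simp [hz, show k ≠ 0 by omega]
  have hz0 : 0 < eta R z := lt_of_le_of_ne (eta_nonneg R z) (Ne.symm hz)
  have hh0 : hh R z = 1 / (R * eta R z) := by simp [hh]
  have h1 : ft (w z) * √(w z + ε) * eta R z ^ 2 / R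
      = (ft (w z) * √(w z + ε) * hh R z) * eta R z ^ 3 := by
    rw [hh0]; field_simp
  have hX : 0 ≤ ft (w z) * √(w z + ε) * hh R z := by
    have := hft z; have := hh_nonneg hR z; positivity
  rw [h1, Real.mul_rpow hX (by positivity)]
  have h2 : (eta R z ^ 3) ^ (1 / 3 : ℝ) = eta R z := by
    rw [← Real.rpow_natCast, ← Real.rpow_mul hz0.le]; norm_num
  rw [h2, mul_pow]
  have h3 : hh R z ^ 4 = 1 / (R ^ 4 * eta R z ^ 4) := by rw [hh0]; field_simp
  rw [h3]
  field_simp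
  ring

theorem EE_cont {n : ℕ} {k : ℕ} (hk : 1 ≤ k) {R : ℝ} (hR : 0 < R) {ft : ℝ → ℝ} {w : XT n → ℝ}
    (hft : ∀ z, 0 ≤ ft (w z)) (cft : Continuous ft) (cw : Continuous w) :
    Continuous (fun q : ℝ × XT n => EE k R ft w q.1 q.2) := by
  have : (fun q : ℝ × XT n => EE k R ft w q.1 q.2) = fun q => eta R q.2 ^ k * ((w q.2 + q.1) ^ 2 / R ^ 4 +
      ((ft (w q.2) * √(w q.2 + q.1) * eta R q.2 ^ 2 / R) ^ (1 / 3 : ℝ)) ^ 4) := by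
    funext q; exact EE_eq hk hR hft q.1 q.2
  rw [this]
  have ce := eta_cont (n := n) R
  have c1 : Continuous (fun q : ℝ × XT n => (ft (w q.2) * √(w q.2 + q.1) * eta R q.2 ^ 2 / R)) := by
    fun_prop
  have c2 := c1.rpow_const (p := (1/3 : ℝ)) (fun q => Or.inr (by norm_num))
  have c3 : Continuous (fun q : ℝ × XT n => (w q.2 + q.1) ^ 2 / R ^ 4) := by fun_prop
  exact (((ce.comp continuous_snd).pow k).mul (c3.add (c2.pow 4)))

theorem EE_nonneg {n : ℕ} {k : ℕ} {R : ℝ} (hR : 0 < R) {ft : ℝ → ℝ} {w : XT n → ℝ}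
    (hft : ∀ z, 0 ≤ ft (w z)) (ε : ℝ) (z : XT n) : 0 ≤ EE k R ft w ε z := by
  unfold EE
  have := hft z; have := hh_nonneg hR z; have := eta_nonneg R z
  positivity

theorem EE_mono {n : ℕ} {k : ℕ} {R : ℝ} (hR : 0 < R) {ft : ℝ → ℝ} {w : XT n → ℝ}
    (hft : ∀ z, 0 ≤ ft (w z)) (hw : ∀ z, 0 ≤ w z) {ε ε' : ℝ} (h0 : 0 ≤ ε) (h : ε ≤ ε') (z : XT n) :
    EE k R ft w ε z ≤ EE k R ft w ε' z := by
  unfold EE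
  have := hft z; have := hh_nonneg hR z; have := eta_nonneg R z; have := hw z
  gcongr

theorem EE_compact {n : ℕ} {k : ℕ} {R : ℝ} (hR : 0 < R) {ft : ℝ → ℝ} {w : XT n → ℝ}
    (ε : ℝ) : HasCompactSupport (EE k R ft w ε) :=
  HasCompactSupport.intro (Box_compact n R) (fun z hz => by simp [EE, eta_off hR hz])

theorem lim_eps {n : ℕ} (hn : 1 ≤ n) {k : ℕ} (hk : 1 ≤ k) {a : ℝ} (ha : 0 < a)
    (hA : 0 < a - ((n : ℝ) - 1) / n * a ^ 2) :
    ∃ C : ℝ, 0 ≤ C ∧ ∀ (f : ℝ → ℝ) (_ : FH f) (u : Reg n) (_ : ∀ z, 0 ≤ u.w z)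
      (_ : ∀ z, u.wt z - ∑ i, u.wii i z = f (u.w z)) (R : ℝ) (_ : 0 < R),
      ∫ z, eta R z ^ (k + 4) * (((n : ℝ) + 2) / n * a * (fTilde f (u.w z) * f (u.w z))
        - ((n : ℝ) - 1) / n * f (u.w z) ^ 2) ≤ C * ∫ z, EE k R (fTilde f) u.w 0 z := by
  obtain ⟨c0, hc0, hb⟩ := cutT_bounds n k
  obtain ⟨C, hC, hmain⟩ := main_eps hn ha hc0 hA
  refine ⟨C, hC, fun f H u hu heq R hR => ?_⟩
  obtain ⟨b1, b2, b3⟩ := hb R hR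
  have hφ : ∀ z, (cutT n k R hR).φ z = eta R z ^ (k + 4) := fun z => rfl
  have hEE : ∀ ε z, EE k R (fTilde f) u.w ε z = (cutT n k R hR).φ z * ((u.w z + ε) ^ 2 * hh R z ^ 4 +
        ((fTilde f (u.w z) * √(u.w z + ε) * hh R z) ^ (1 / 3 : ℝ)) ^ 4) := fun ε z => rfl
  generalize cutT n k R hR = T at b1 b2 b3 hφ hEE
  have hn1 : (1:ℝ) ≤ n := by exact_mod_cast hn
  have hft : ∀ z, 0 ≤ fTilde f (u.w z) := fun z => H.ft_nonneg (hu z)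
  have hfw : ∀ z, f0 f (u.w z) = f (u.w z) := fun z => FH.f0_of_nonneg (hu z)
  have hf0 : ∀ z, 0 ≤ f (u.w z) := fun z => H.f_nonneg (hu z)
  have hp : ∀ j : ℕ, 0 < 1 / ((j : ℝ) + 1) := fun j => by positivity
  have hp1 : ∀ j : ℕ, 1 / ((j : ℝ) + 1) ≤ 1 := fun j => by
    rw [div_le_one (by positivity)]; have : (0:ℝ) ≤ j := by positivity
    linarith
  have hcE := EE_cont hk hR hft H.ft_cont u.cont
  have cE : ∀ ε, Continuous (EE k R (fTilde f) u.w ε) := fun ε =>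
    Continuous.uncurry_left (f := EE k R (fTilde f) u.w) ε hcE
  have iE : ∀ ε, Integrable (EE k R (fTilde f) u.w ε) := fun ε =>
    (cE ε).integrable_of_hasCompactSupport (EE_compact hR ε)
  have cf : Continuous (fun z => f (u.w z)) := by
    have := H.f0_cont.comp u.cont
    refine this.congr (fun z => hfw z)
  have cG : ∀ j : ℕ, Continuous (fun z => Geps f (1 / ((j : ℝ) + 1)) (u.w z)) := fun j =>
    (H.G_cont (hp j)).comp u.cont
  have cft : Continuous (fun z => fTilde f (u.w z)) := H.ft_cont.comp u.cont
  have ce := eta_cont (n := n) R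
  have step : ∀ j : ℕ, ∫ z, eta R z ^ (k + 4) * (((n : ℝ) + 2) / n * a *
      (Geps f (1 / ((j : ℝ) + 1)) (u.w z) * f (u.w z))
        - ((n : ℝ) - 1) / n * f (u.w z) ^ 2) ≤ C * ∫ z, EE k R (fTilde f) u.w (1 / ((j : ℝ) + 1)) z := by
    intro j
    have := hmain T (hh R) u (1 / ((j : ℝ) + 1)) (f0 f) (fTilde f)
      (Geps f (1 / ((j : ℝ) + 1))) (GGeps f (1 / ((j : ℝ) + 1))) (Fp f)
      (EE k R (fTilde f) u.w (1 / ((j : ℝ) + 1))) (hh_nonneg hR) b1 b2 b3 hu (hp j) H.f0_cont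
      (fun z => by rw [hfw]; exact heq z) (H.G_deriv (hp j)) (H.GG_deriv (hp j)) H.F_deriv
      (H.fun_bounds (hp j)) (iE _) (fun z => (hEE _ z).ge)
    simp only [hfw, hφ] at this
    exact this
  have lR : Tendsto (fun j : ℕ => C * ∫ z, EE k R (fTilde f) u.w (1 / ((j : ℝ) + 1)) z) atTop
      (nhds (C * ∫ z, EE k R (fTilde f) u.w 0 z)) := by
    refine Tendsto.const_mul _ ?_
    refine tendsto_integral_of_dominated_convergence (EE k R (fTilde f) u.w 1)
      (fun j => (cE _).aestronglyMeasurable) (iE 1) (fun j => ae_of_all _ fun z => ?_)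
      (ae_of_all _ fun z => ?_)
    · rw [Real.norm_eq_abs, abs_of_nonneg (EE_nonneg hR hft _ z)]
      exact EE_mono hR hft hu (hp j).le (hp1 j) z
    · have c1 : Continuous (fun ε : ℝ => EE k R (fTilde f) u.w ε z) :=
        Continuous.uncurry_right (f := EE k R (fTilde f) u.w) z hcE
      exact (c1.tendsto 0).comp tendsto_one_div_add_atTop_nhds_zero_nat
  have lL : Tendsto (fun j : ℕ => ∫ z, eta R z ^ (k + 4) * (((n : ℝ) + 2) / n * a *
      (Geps f (1 / ((j : ℝ) + 1)) (u.w z) * f (u.w z))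
        - ((n : ℝ) - 1) / n * f (u.w z) ^ 2)) atTop
      (nhds (∫ z, eta R z ^ (k + 4) * (((n : ℝ) + 2) / n * a * (fTilde f (u.w z) * f (u.w z))
        - ((n : ℝ) - 1) / n * f (u.w z) ^ 2))) := by
    refine tendsto_integral_of_dominated_convergence
      (fun z => eta R z ^ (k + 4) * (((n : ℝ) + 2) / n * a * (fTilde f (u.w z) * f (u.w z))
        + ((n : ℝ) - 1) / n * f (u.w z) ^ 2))
      (fun j => ?_) ?_ (fun j => ae_of_all _ fun z => ?_) (ae_of_all _ fun z => ?_)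
    · have := cG j
      exact ((ce.pow (k+4)).mul ((continuous_const.mul (this.mul cf)).sub (continuous_const.mul (cf.pow 2)))).aestronglyMeasurable
    · refine ((ce.pow (k+4)).mul ((continuous_const.mul (cft.mul cf)).add (continuous_const.mul (cf.pow 2)))).integrable_of_hasCompactSupport
        (HasCompactSupport.intro (Box_compact n R) (fun z hz => by simp [eta_off hR hz]))
    · have e0 := eta_nonneg R z
      have g0 := H.G_nonneg (hp j) (hu z)
      have g1 := H.G_le (hp j) (hu z)
      have f1 := hf0 z
      have hγ : 0 ≤ ((n : ℝ) - 1) / n := div_nonneg (by linarith) (by linarith)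
      rw [Real.norm_eq_abs, abs_mul, abs_of_nonneg (pow_nonneg e0 _)]
      gcongr
      refine (abs_sub _ _).trans ?_
      rw [abs_of_nonneg (by positivity), abs_of_nonneg (by positivity)]
      gcongr
    · exact ((((H.G_tendsto (hu z)).mul_const _).const_mul _).sub_const _).const_mul _
  exact le_of_tendsto_of_tendsto' lL lR step

theorem choose_a {n : ℕ} (hn : 1 ≤ n) {f : ℝ → ℝ} (H : FH f)
    (hA : n = 1 ∨ ∃ p : ℝ, 1 < p ∧ p < ((n : ℝ) * ((n : ℝ) + 2)) / ((n : ℝ) - 1) ^ 2 ∧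
      ∀ s : ℝ, 0 < s → f s ≤ p * fTilde f s) :
    ∃ a : ℝ, 0 < a ∧ 0 < a - ((n : ℝ) - 1) / n * a ^ 2 ∧ ∃ θ : ℝ, 0 < θ ∧ ∀ s, 0 ≤ s →
      θ * (fTilde f s * f s) ≤ ((n : ℝ) + 2) / n * a * (fTilde f s * f s)
        - ((n : ℝ) - 1) / n * f s ^ 2 := by
  by_cases h1 : n = 1
  · subst h1
    refine ⟨1, one_pos, by norm_num, 3, by norm_num, fun s hs => ?_⟩
    norm_num
  · obtain ⟨p, hp1, hp, hfp⟩ := hA.resolve_left h1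
    have hn2 : (2:ℝ) ≤ n := by exact_mod_cast (by omega : 2 ≤ n)
    have hm : 0 < (n:ℝ) - 1 := by linarith
    have hn0 : 0 < (n:ℝ) := by linarith
    have hlt : p * (n - 1) / (n + 2) < n / ((n:ℝ) - 1) := by
      rw [div_lt_div_iff₀ (by linarith) hm]
      rw [lt_div_iff₀ (by positivity)] at hp
      linarith
    obtain ⟨a, ha1, ha2⟩ := exists_between hlt
    have ha0 : 0 < a := lt_trans (by positivity) ha1
    rw [div_lt_iff₀ (by linarith)] at ha1
    rw [lt_div_iff₀ hm] at ha2
    refine ⟨a, ha0, ?_, ((n : ℝ) + 2) / n * a - (n - 1) / n * p, ?_, fun s hs => ?_⟩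
    · have : a - ((n : ℝ) - 1) / n * a ^ 2 = a * (n - a * (n - 1)) / n := by field_simp
      rw [this]
      exact div_pos (mul_pos ha0 (by linarith)) hn0
    · have : ((n : ℝ) + 2) / n * a - (n - 1) / n * p = (a * (n + 2) - p * (n - 1)) / n := by
        field_simp
      rw [this]
      exact div_pos (by linarith) hn0
    · have hγ : 0 < ((n:ℝ) - 1) / n := by positivity
      have key : f s ^ 2 ≤ p * (fTilde f s * f s) := by
        rcases hs.eq_or_lt with rfl | h
        · have e : f 0 = 0 := le_antisymm (H.f_zero_le hfp) (H.f_nonneg le_rfl)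
          simp [e]
        · have := mul_le_mul_of_nonneg_right (hfp s h) (H.pos s h).le
          linarith
      have := mul_le_mul_of_nonneg_left key hγ.le
      linarith

theorem young_rpow {α β γ δ : ℝ} (hα : 0 < α) (hαβ : α < β) (hδ : 0 < δ) :
    ∃ C : ℝ, 0 ≤ C ∧ ∀ X h : ℝ, 0 < X → 0 < h →
      X ^ α * h ^ γ ≤ δ * X ^ β + C * h ^ (γ * β / (β - α)) := by
  have hd : 0 < β - α := by linarith
  refine ⟨(1 / δ) ^ (α / (β - α)), by positivity, fun X h hX hh => ?_⟩
  have hC : 0 ≤ (1 / δ) ^ (α / (β - α)) * h ^ (γ * β / (β - α)) := by positivity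
  have hC2 : 0 ≤ δ * X ^ β := by positivity
  by_cases hc : h ^ γ ≤ δ * X ^ (β - α)
  · have : X ^ α * h ^ γ ≤ δ * X ^ β := by
      calc _ ≤ X ^ α * (δ * X ^ (β - α)) := by gcongr
        _ = δ * (X ^ α * X ^ (β - α)) := by ring
        _ = _ := by rw [← Real.rpow_add hX]; congr 2; ring
    linarith
  · push Not at hc
    have h1 : X ^ (β - α) ≤ (1 / δ) * h ^ γ := by
      rw [one_div, ← div_eq_inv_mul, le_div_iff₀ hδ]; linarith
    have h2 : X ^ α ≤ ((1 / δ) * h ^ γ) ^ (α / (β - α)) := by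
      calc X ^ α = (X ^ (β - α)) ^ (α / (β - α)) := by
            rw [← Real.rpow_mul hX.le]; congr 1; field_simp
        _ ≤ _ := by gcongr
    have h3 : X ^ α * h ^ γ ≤ (1 / δ) ^ (α / (β - α)) * h ^ (γ * β / (β - α)) := by
      calc _ ≤ ((1 / δ) * h ^ γ) ^ (α / (β - α)) * h ^ γ := by gcongr
        _ = (1 / δ) ^ (α / (β - α)) * (h ^ (γ * (α / (β - α))) * h ^ γ) := by
          rw [Real.mul_rpow (by positivity) (by positivity), ← Real.rpow_mul hh.le]; ring
        _ = _ := by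
          rw [← Real.rpow_add hh]; congr 2; field_simp; ring
    linarith

theorem term2 {m c δ : ℝ} (hm : 2 / 3 < m) (hc : 0 < c) (hδ : 0 < δ) :
    ∃ C : ℝ, 0 ≤ C ∧ ∀ X h P : ℝ, 0 < X → 0 < h → c * X ^ (2 * m) ≤ P →
      ((X * h) ^ (1 / 3 : ℝ)) ^ 4 ≤ δ * P + C * h ^ (4 * m / (3 * m - 2)) := by
  obtain ⟨C, hC, H⟩ := young_rpow (α := 4 / 3) (β := 2 * m) (γ := 4 / 3) (δ := δ * c) (by norm_num)
    (by linarith) (by positivity)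
  refine ⟨C, hC, fun X h P hX hh hP => ?_⟩
  have h1 := H X h hX hh
  have e1 : ((X * h) ^ (1 / 3 : ℝ)) ^ 4 = X ^ (4 / 3 : ℝ) * h ^ (4 / 3 : ℝ) := by
    rw [← Real.mul_rpow hX.le hh.le, ← Real.rpow_natCast, ← Real.rpow_mul (by positivity)]
    norm_num
  have e2 : 4 / 3 * (2 * m) / (2 * m - 4 / 3) = 4 * m / (3 * m - 2) := by
    have : 3 * m - 2 ≠ 0 := by linarith
    have : 2 * m - 4 / 3 ≠ 0 := by linarith
    rw [div_eq_div_iff (by assumption) (by assumption)]; ring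
  rw [e1]; rw [e2] at h1
  have := mul_le_mul_of_nonneg_left hP hδ.le
  linarith

theorem term1 {m c K δ : ℝ} (hm : 2 / 3 < m) (hm1 : m < 1) (hc : 0 < c) (hK : 0 < K) (hδ : 0 < δ) :
    ∃ C : ℝ, 0 ≤ C ∧ ∀ X h P s : ℝ, 0 < X → 0 < h → 0 < s → c * X ^ (2 * m) ≤ P →
      s ≤ K * X ^ (2 - 2 * m) →
      s ^ 2 * h ^ 4 ≤ δ * P + C * h ^ (4 * m / (3 * m - 2)) := by
  obtain ⟨C, hC, H⟩ := young_rpow (α := 4 - 4 * m) (β := 2 * m) (γ := 4) (δ := δ * c / K ^ 2) (by linarith)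
    (by linarith) (by positivity)
  refine ⟨K ^ 2 * C, by positivity, fun X h P s hX hh hs hP hsK => ?_⟩
  have h1 := mul_le_mul_of_nonneg_left (H X h hX hh) (by positivity : 0 ≤ K ^ 2)
  have e2 : 4 * (2 * m) / (2 * m - (4 - 4 * m)) = 4 * m / (3 * m - 2) := by
    have : 3 * m - 2 ≠ 0 := by linarith
    have : 2 * m - (4 - 4 * m) ≠ 0 := by linarith
    rw [div_eq_div_iff (by assumption) (by assumption)]; ring
  rw [e2] at h1
  have e3 : K ^ 2 * (δ * c / K ^ 2 * X ^ (2 * m) + C * h ^ (4 * m / (3 * m - 2)))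
     = δ * (c * X ^ (2 * m)) + K ^ 2 * C * h ^ (4 * m / (3 * m - 2)) := by field_simp
  rw [e3] at h1
  have h2 := mul_le_mul_of_nonneg_left hP hδ.le
  have h3 : s ^ 2 * h ^ 4 ≤ K ^ 2 * (X ^ (4 - 4 * m) * h ^ (4 : ℝ)) := by
    have e4 : X ^ (4 - 4 * m) = (X ^ (2 - 2 * m)) ^ 2 := by
      rw [← Real.rpow_natCast, ← Real.rpow_mul hX.le]; congr 1; push_cast; ring
    have e5 : h ^ (4:ℝ) = h ^ 4 := by rw [← Real.rpow_natCast]; norm_num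
    rw [e4, e5, ← mul_assoc, ← mul_pow]
    gcongr
  linarith

theorem q_gt {n : ℕ} {m : ℝ} (hm : 2 / 3 < m) (h : m < 2 * ((n : ℝ) + 2) / (3 * (n : ℝ) + 2)) :
    (n : ℝ) + 2 < 4 * m / (3 * m - 2) := by
  rw [lt_div_iff₀ (by positivity)] at h
  rw [lt_div_iff₀ (by linarith)]
  linarith

theorem growth {f : ℝ → ℝ} (H : FH f) {m c s0 S : ℝ} (hm : 0 < m) (hm1 : m < 1) (hs0 : 0 ≤ s0)
    (hS : s0 ≤ S) (hB : ∀ s, s0 < s → s < S → c * s ^ m * fTilde f s ^ (2 * m - 1) ≤ f s) :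
    (2 - 2 * m) * c / m * (S ^ m - s0 ^ m) ≤ fTilde f S ^ (2 - 2 * m) - fTilde f s0 ^ (2 - 2 * m) := by
  set K : ℝ → ℝ := fun s => fTilde f s ^ (2 - 2 * m) - (2 - 2 * m) * c / m * s ^ m with hK
  have hmono : MonotoneOn K (Icc s0 S) := by
    have hder : ∀ x ∈ Ioo s0 S, HasDerivAt K (f x / x * (2 - 2 * m) * fTilde f x ^ (2 - 2 * m - 1)
        - (2 - 2 * m) * c / m * (m * x ^ (m - 1))) x := by
      intro x hx
      have hx0 : 0 < x := lt_of_le_of_lt hs0 hx.1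
      have h1 := (H.ft_deriv hx0).rpow_const (p := 2 - 2 * m) (Or.inl (H.ft_pos hx0).ne')
      have h2 := (Real.hasDerivAt_rpow_const (x := x) (p := m) (Or.inl hx0.ne')).const_mul
        ((2 - 2 * m) * c / m)
      exact h1.sub h2
    apply monotoneOn_of_deriv_nonneg (convex_Icc _ _)
    · apply Continuous.continuousOn
      exact (H.ft_cont.rpow_const (fun x => Or.inr (by linarith))).sub
        (continuous_const.mul (continuous_id.rpow_const (fun x => Or.inr hm.le)))
    · rw [interior_Icc]
      exact fun x hx => (hder x hx).differentiableAt.differentiableWithinAt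
    · rw [interior_Icc]
      intro x hx
      rw [(hder x hx).deriv]
      have hx0 : 0 < x := lt_of_le_of_lt hs0 hx.1
      have hp := H.ft_pos hx0
      have h1 := hB x hx.1 hx.2
      have h2 : c * x ^ (m - 1) ≤ f x / x * fTilde f x ^ (1 - 2 * m) := by
        calc c * x ^ (m - 1) = (c * x ^ m * fTilde f x ^ (2 * m - 1)) / x * fTilde f x ^ (1 - 2 * m) := by
              have e : fTilde f x ^ (2 * m - 1) * fTilde f x ^ (1 - 2 * m) = 1 := by
                rw [← Real.rpow_add hp]; norm_num
              rw [Real.rpow_sub hx0, Real.rpow_one]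
              calc _ = c * (x ^ m / x) * 1 := by ring
                _ = c * (x ^ m / x) * (fTilde f x ^ (2 * m - 1) * fTilde f x ^ (1 - 2 * m)) := by rw [e]
                _ = _ := by ring
          _ ≤ _ := by gcongr
      have e3 : 2 - 2 * m - 1 = 1 - 2 * m := by ring
      rw [e3]
      have e4 : (2 - 2 * m) * c / m * (m * x ^ (m - 1)) = (2 - 2 * m) * (c * x ^ (m - 1)) := by
        field_simp
      rw [e4]
      have := mul_le_mul_of_nonneg_left h2 (by linarith : 0 ≤ 2 - 2 * m)
      linarith
  have := hmono (left_mem_Icc.2 hS) (right_mem_Icc.2 hS) hS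
  simp only [hK] at this
  linarith

theorem X_pow {s t m : ℝ} (hs : 0 < s) (ht : 0 < t) : (t * √s) ^ (2 * m) = s ^ m * t ^ (2 * m) := by
  rw [Real.mul_rpow ht.le (Real.sqrt_nonneg _), Real.sqrt_eq_rpow, ← Real.rpow_mul hs.le, mul_comm]
  congr 2; ring

theorem le_X {s t m c : ℝ} (hs : 0 < s) (ht : 0 < t) (hc : 0 < c) (h : c * s ^ m ≤ t ^ (2 - 2 * m)) :
    s ≤ 1 / c * (t * √s) ^ (2 - 2 * m) := by
  have e : (2 - 2 * m) = 2 * (1 - m) := by ring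
  rw [e, X_pow hs ht, ← e]
  calc s = 1 / c * (s ^ (1 - m) * (c * s ^ m)) := by
        have : s ^ (1 - m) * s ^ m = s := by rw [← Real.rpow_add hs]; norm_num
        calc s = s ^ (1 - m) * s ^ m := this.symm
          _ = _ := by field_simp
    _ ≤ _ := by gcongr

theorem pw_B {n : ℕ} (hn : 1 ≤ n) {f : ℝ → ℝ} (H : FH f)
    (hB : ∃ c : ℝ, 0 < c ∧ ∃ m₁ m₂ : ℝ,
      2 / 3 < m₂ ∧ m₂ < m₁ ∧ m₁ < 2 * ((n : ℝ) + 2) / (3 * (n : ℝ) + 2) ∧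
      (∀ s ∈ Ioc (0 : ℝ) 1, c * s ^ m₁ * fTilde f s ^ (2 * m₁ - 1) ≤ f s) ∧
      (∀ s : ℝ, 1 < s → c * s ^ m₂ * fTilde f s ^ (2 * m₂ - 1) ≤ f s)) :
    ∃ q1 q2 q3 : ℝ, (n : ℝ) + 2 < q1 ∧ (n : ℝ) + 2 < q2 ∧ (n : ℝ) + 2 < q3 ∧
      ∀ δ : ℝ, 0 < δ → ∃ C : ℝ, 0 ≤ C ∧ ∀ s h : ℝ, 0 ≤ s → 0 < h →
        s ^ 2 * h ^ 4 + ((fTilde f s * √s * h) ^ (1 / 3 : ℝ)) ^ 4 ≤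
          δ * (fTilde f s * f s) + C * (h ^ q1 + h ^ q2 + h ^ q3) := by
  obtain ⟨c, hc, m1, m2, h2, h21, h1, hB1, hB2⟩ := hB
  have hP : ∀ s m c : ℝ, 0 < s → c * s ^ m * fTilde f s ^ (2 * m - 1) ≤ f s →
      c * (fTilde f s * √s) ^ (2 * m) ≤ fTilde f s * f s := by
    intro s m c hs h
    have hp := H.ft_pos hs
    rw [X_pow hs hp]
    have e : fTilde f s ^ (2 * m) = fTilde f s ^ (2 * m - 1) * fTilde f s := by
      rw [Real.rpow_sub hp, Real.rpow_one]; field_simp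
    rw [e]
    have := mul_le_mul_of_nonneg_left h hp.le
    linarith
  have R1 : ∃ q3 : ℝ, (n : ℝ) + 2 < q3 ∧ ∀ δ : ℝ, 0 < δ → ∃ C : ℝ, 0 ≤ C ∧ ∀ s h : ℝ,
      0 < s → s ≤ 1 → 0 < h → s ^ 2 * h ^ 4 ≤ δ * (fTilde f s * f s) + C * h ^ q3 := by
    by_cases hn1 : n = 1
    · subst hn1
      refine ⟨4, by norm_num, fun δ hδ => ⟨1, by norm_num, fun s h hs hs1 hh => ?_⟩⟩
      have e5 : h ^ (4:ℝ) = h ^ 4 := by rw [← Real.rpow_natCast]; norm_num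
      rw [e5]
      have : 0 ≤ δ * (fTilde f s * f s) := by
        have := H.ft_pos hs; have := H.pos s hs; positivity
      have : s ^ 2 * h ^ 4 ≤ 1 * h ^ 4 := by
        gcongr; nlinarith
      linarith
    · have hn2 : (2:ℝ) ≤ n := by exact_mod_cast (by omega : 2 ≤ n)
      have hm1 : m1 < 1 := by
        refine lt_of_lt_of_le h1 ?_
        rw [div_le_one (by positivity)]; linarith
      refine ⟨4 * m1 / (3 * m1 - 2), q_gt (by linarith) h1, fun δ hδ => ?_⟩
      set c' := (2 - 2 * m1) * c / m1 with hc'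
      have hc'0 : 0 < c' := div_pos (mul_pos (by linarith) hc) (by linarith)
      obtain ⟨C, hC, hT⟩ := term1 (m := m1) (c := c) (K := 1 / c') (δ := δ) (by linarith) hm1 hc
        (by positivity) hδ
      refine ⟨C, hC, fun s h hs hs1 hh => ?_⟩
      have hp := H.ft_pos hs
      refine hT (fTilde f s * √s) h _ s (by positivity) hh hs (hP s m1 c hs (hB1 s ⟨hs, hs1⟩)) ?_
      refine le_X hs hp hc'0 ?_
      have := growth H (m := m1) (c := c) (s0 := 0) (S := s) (by linarith) hm1 le_rfl hs.le
        (fun x hx hxs => hB1 x ⟨hx, by linarith⟩)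
      rw [FH.ft_zero, Real.zero_rpow (by linarith), Real.zero_rpow (by linarith)] at this
      linarith
  set m := min m2 (9 / 10) with hm
  have hm23 : 2 / 3 < m := lt_min h2 (by norm_num)
  have hmlt1 : m < 1 := lt_of_le_of_lt (min_le_right _ _) (by norm_num)
  have hmm2 : m ≤ m2 := min_le_left _ _
  have hmlt : m < 2 * ((n : ℝ) + 2) / (3 * (n : ℝ) + 2) := by linarith
  set b := fTilde f 1 with hb
  have hb0 : 0 < b := H.ft_pos one_pos
  set c2 := c * b ^ (2 * m2 - 2 * m) with hc2
  have hc20 : 0 < c2 := by positivity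
  have hB2' : ∀ s : ℝ, 1 < s → c2 * s ^ m * fTilde f s ^ (2 * m - 1) ≤ f s := by
    intro s hs
    have hs0 : 0 < s := by linarith
    have hp := H.ft_pos hs0
    refine le_trans ?_ (hB2 s hs)
    have e1 : s ^ m2 = s ^ m * s ^ (m2 - m) := by rw [← Real.rpow_add hs0]; congr 1; ring
    have e2 : fTilde f s ^ (2 * m2 - 1) = fTilde f s ^ (2 * m - 1) * fTilde f s ^ (2 * m2 - 2 * m) := by
      rw [← Real.rpow_add hp]; congr 1; ring
    have i1 : 1 ≤ s ^ (m2 - m) := Real.one_le_rpow hs.le (by linarith)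
    have i2 : b ^ (2 * m2 - 2 * m) ≤ fTilde f s ^ (2 * m2 - 2 * m) :=
      Real.rpow_le_rpow hb0.le (H.ft_mono hs.le) (by linarith)
    rw [e1, e2, hc2]
    calc _ = c * (s ^ m * 1) * (fTilde f s ^ (2 * m - 1) * b ^ (2 * m2 - 2 * m)) := by ring
      _ ≤ _ := by gcongr
  have R2 : ∃ K : ℝ, 0 < K ∧ ∀ s : ℝ, 1 < s → s ≤ K * (fTilde f s * √s) ^ (2 - 2 * m) := by
    set c3 := min ((2 - 2 * m) * c2 / m) (b ^ (2 - 2 * m)) with hc3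
    have hc30 : 0 < c3 := lt_min (div_pos (mul_pos (by linarith) hc20) (by linarith)) (by positivity)
    refine ⟨1 / c3, by positivity, fun s hs => ?_⟩
    have hs0 : 0 < s := by linarith
    refine le_X hs0 (H.ft_pos hs0) hc30 ?_
    have := growth H (m := m) (c := c2) (s0 := 1) (S := s) (by linarith) hmlt1 zero_le_one hs.le
        (fun x hx hxs => hB2' x hx)
    rw [Real.one_rpow, ← hb] at this
    have i1 : 1 ≤ s ^ m := Real.one_le_rpow hs.le (by linarith)
    have i2 : c3 ≤ (2 - 2 * m) * c2 / m := min_le_left _ _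
    have i3 : c3 ≤ b ^ (2 - 2 * m) := min_le_right _ _
    have := mul_le_mul_of_nonneg_right i2 (by linarith : 0 ≤ s ^ m - 1)
    linarith
  obtain ⟨q3, hq3, hR1⟩ := R1
  obtain ⟨K, hK, hR2⟩ := R2
  refine ⟨4 * m1 / (3 * m1 - 2), 4 * m / (3 * m - 2), q3, q_gt (by linarith) h1, q_gt hm23 hmlt, hq3,
    fun δ hδ => ?_⟩
  obtain ⟨C1, hC1, hT1⟩ := hR1 (δ / 2) (by positivity)
  obtain ⟨C2, hC2, hT2⟩ := term2 (m := m1) (c := c) (δ := δ / 2) (by linarith) hc (by positivity)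
  obtain ⟨C3, hC3, hT3⟩ := term1 (m := m) (c := c2) (K := K) (δ := δ / 2) hm23 hmlt1 hc20 hK (by positivity)
  obtain ⟨C4, hC4, hT4⟩ := term2 (m := m) (c := c2) (δ := δ / 2) hm23 hc20 (by positivity)
  refine ⟨C1 + C2 + C3 + C4, by positivity, fun s h hs hh => ?_⟩
  have p1 : 0 < h ^ (4 * m1 / (3 * m1 - 2)) := by positivity
  have p2 : 0 < h ^ (4 * m / (3 * m - 2)) := by positivity
  have p3 : 0 < h ^ q3 := by positivity
  set y1 := h ^ (4 * m1 / (3 * m1 - 2))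
  set y2 := h ^ (4 * m / (3 * m - 2))
  set y3 := h ^ q3
  rcases hs.eq_or_lt with rfl | hs0
  · simp [FH.ft_zero]; positivity
  have hp := H.ft_pos hs0
  rcases le_or_gt s 1 with hs1 | hs1
  · have a1 := hT1 s h hs0 hs1 hh
    have a2 := hT2 (fTilde f s * √s) h _ (by positivity) hh (hP s m1 c hs0 (hB1 s ⟨hs0, hs1⟩))
    have a3 : 0 ≤ (C1 + C2 + C3 + C4) * (y1 + y2 + y3) - C1 * y3 - C2 * y1 := by
      have : (C1 + C2 + C3 + C4) * (y1 + y2 + y3) - C1 * y3 - C2 * y1 =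
        (C1 + C3 + C4) * y1 + (C1 + C2 + C3 + C4) * y2 + (C2 + C3 + C4) * y3 := by ring
      rw [this]; positivity
    linarith
  · have a1 := hT3 (fTilde f s * √s) h _ s (by positivity) hh hs0 (hP s m c2 hs0 (hB2' s hs1)) (hR2 s hs1)
    have a2 := hT4 (fTilde f s * √s) h _ (by positivity) hh (hP s m c2 hs0 (hB2' s hs1))
    have a3 : 0 ≤ (C1 + C2 + C3 + C4) * (y1 + y2 + y3) - C3 * y2 - C4 * y2 := by
      have : (C1 + C2 + C3 + C4) * (y1 + y2 + y3) - C3 * y2 - C4 * y2 =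
        (C1 + C2 + C3 + C4) * y1 + (C1 + C2) * y2 + (C1 + C2 + C3 + C4) * y3 := by ring
      rw [this]; positivity
    linarith

theorem phi_h {n N : ℕ} {R q : ℝ} (hR : 0 < R) (hq : q ≤ N) {z : XT n} (hz : 0 < eta R z) :
    eta R z ^ N * hh R z ^ q ≤ R ^ (-q) := by
  have e1 := eta_le_one R z
  unfold hh
  rw [Real.inv_rpow (by positivity), ← Real.rpow_neg (by positivity), Real.mul_rpow hR.le hz.le,
    ← Real.rpow_natCast]
  have : eta R z ^ (N:ℝ) * (R ^ (-q) * eta R z ^ (-q)) = R ^ (-q) * eta R z ^ (N - q) := by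
    rw [sub_eq_add_neg, Real.rpow_add hz]; ring
  rw [this]
  have h1 : eta R z ^ ((N:ℝ) - q) ≤ 1 := Real.rpow_le_one hz.le e1 (by linarith)
  have h2 : 0 ≤ R ^ (-q) := by positivity
  nlinarith

theorem final_reg {n : ℕ} (hn : 1 ≤ n) {f : ℝ → ℝ} (H : FH f)
    (hA : n = 1 ∨ ∃ p : ℝ, 1 < p ∧ p < ((n : ℝ) * ((n : ℝ) + 2)) / ((n : ℝ) - 1) ^ 2 ∧
      ∀ s : ℝ, 0 < s → f s ≤ p * fTilde f s)
    (hB : ∃ c : ℝ, 0 < c ∧ ∃ m₁ m₂ : ℝ,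
      2 / 3 < m₂ ∧ m₂ < m₁ ∧ m₁ < 2 * ((n : ℝ) + 2) / (3 * (n : ℝ) + 2) ∧
      (∀ s ∈ Ioc (0 : ℝ) 1, c * s ^ m₁ * fTilde f s ^ (2 * m₁ - 1) ≤ f s) ∧
      (∀ s : ℝ, 1 < s → c * s ^ m₂ * fTilde f s ^ (2 * m₂ - 1) ≤ f s))
    (u : Reg n) (hu : ∀ z, 0 ≤ u.w z) (heq : ∀ z, u.wt z - ∑ i, u.wii i z = f (u.w z)) :
    ∀ z, u.w z = 0 := by
  obtain ⟨a, ha, hAa, θ, hθ, hθf⟩ := choose_a hn H hA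
  obtain ⟨q1, q2, q3, hq1, hq2, hq3, hpw⟩ := pw_B hn H hB
  obtain ⟨k, hk1, hk⟩ : ∃ k : ℕ, 1 ≤ k ∧ (max q1 (max q2 q3)) ≤ k :=
    ⟨⌈max q1 (max q2 q3)⌉₊ + 1, by omega, by push_cast; linarith [Nat.le_ceil (max q1 (max q2 q3))]⟩
  obtain ⟨C0, hC0, hlim⟩ := lim_eps hn hk1 ha hAa
  set δ := θ / (2 * (C0 + 1)) with hδ
  have hδ0 : 0 < δ := by positivity
  obtain ⟨C, hC, hCp⟩ := hpw δ hδ0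
  set q := min q1 (min q2 q3) with hq
  have hqn : (n:ℝ) + 2 < q := lt_min hq1 (lt_min hq2 hq3)
  have hft : ∀ z, 0 ≤ fTilde f (u.w z) := fun z => H.ft_nonneg (hu z)
  have hf0 : ∀ z, 0 ≤ f (u.w z) := fun z => H.f_nonneg (hu z)
  have cf : Continuous (fun z => f (u.w z)) :=
    (H.f0_cont.comp u.cont).congr (fun z => FH.f0_of_nonneg (hu z))
  have cft : Continuous (fun z => fTilde f (u.w z)) := H.ft_cont.comp u.cont
  set P : XT n → ℝ := fun z => fTilde f (u.w z) * f (u.w z) with hP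
  have cP : Continuous P := cft.mul cf
  have hP0 : ∀ z, 0 ≤ P z := fun z => mul_nonneg (hft z) (hf0 z)
  have cφ : ∀ R, Continuous (fun z : XT n => eta R z ^ (k + 4) * P z) := fun R =>
    ((eta_cont R).pow _).mul cP
  have sφ : ∀ R, 0 < R → HasCompactSupport (fun z : XT n => eta R z ^ (k + 4) * P z) := fun R hR =>
    HasCompactSupport.intro (Box_compact n R) (fun z hz => by simp [eta_off hR hz])
  have iφ : ∀ R, 0 < R → Integrable (fun z : XT n => eta R z ^ (k + 4) * P z) := fun R hR =>
    (cφ R).integrable_of_hasCompactSupport (sφ R hR)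
  have hbound : ∀ R : ℝ, 1 ≤ R → ∫ z, eta R z ^ (k + 4) * P z ≤
      (2 / θ * C0 * (3 * C) * 2 ^ (n + 1)) * R ^ (-(q - (n + 2))) := by
    intro R hR1
    have hR : 0 < R := by linarith
    have h1 := hlim f H u hu heq R hR
    have ce := eta_cont (n := n) R
    have iL : Integrable (fun z : XT n => eta R z ^ (k + 4) * (((n : ℝ) + 2) / n * a * P z
        - ((n : ℝ) - 1) / n * f (u.w z) ^ 2)) := by
      refine Continuous.integrable_of_hasCompactSupport ?_
        (HasCompactSupport.intro (Box_compact n R) (fun z hz => by simp [eta_off hR hz]))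
      exact (ce.pow (k+4)).mul ((continuous_const.mul cP).sub (continuous_const.mul (cf.pow 2)))
    have h2 : θ * ∫ z, eta R z ^ (k + 4) * P z ≤ ∫ z, eta R z ^ (k + 4) * (((n : ℝ) + 2) / n * a * P z
        - ((n : ℝ) - 1) / n * f (u.w z) ^ 2) := by
      rw [← integral_const_mul]
      refine integral_mono ((iφ R hR).const_mul θ) iL (fun z => ?_)
      have := mul_le_mul_of_nonneg_left (hθf (u.w z) (hu z)) (pow_nonneg (eta_nonneg R z) (k + 4))
      simp only [hP]
      linarith
    have hBm : MeasurableSet (Box n R) := (Box_compact n R).isClosed.measurableSet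
    have iI : Integrable (indicator (Box n R) (fun _ => 3 * C * R ^ (-q))) :=
      (integrable_indicator_iff hBm).2 (integrableOn_const (Box_compact n R).measure_lt_top.ne)
    have hEpt : ∀ z, EE k R (fTilde f) u.w 0 z ≤ δ * (eta R z ^ (k + 4) * P z) +
        indicator (Box n R) (fun _ => 3 * C * R ^ (-q)) z := by
      intro z
      have hind : 0 ≤ indicator (Box n R) (fun _ => 3 * C * R ^ (-q)) z :=
        indicator_nonneg (fun _ _ => by positivity) z
      by_cases hz : eta R z = 0
      · simp only [EE, hz]
        simpa using hind
      have hz0 : 0 < eta R z := lt_of_le_of_ne (eta_nonneg R z) (Ne.symm hz)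
      have hmem : z ∈ Box n R := by
        by_contra h; exact hz (eta_off hR h)
      rw [indicator_of_mem hmem]
      have hh0 : 0 < hh R z := by unfold hh; positivity
      have h3 := mul_le_mul_of_nonneg_left (hCp (u.w z) (hh R z) (hu z) hh0)
        (pow_nonneg (eta_nonneg R z) (k + 4))
      have hx : ∀ q', q' ≤ max q1 (max q2 q3) → q ≤ q' →
          eta R z ^ (k + 4) * hh R z ^ q' ≤ R ^ (-q) := by
        intro q' hq1 hq2
        refine (phi_h hR ?_ hz0).trans ?_
        · push_cast; linarith
        · exact Real.rpow_le_rpow_of_exponent_le hR1 (by linarith)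
      have x1 := hx q1 (le_max_left _ _) (min_le_left _ _)
      have x2 := hx q2 ((le_max_left _ _).trans (le_max_right _ _))
        ((min_le_right _ _).trans (min_le_left _ _))
      have x3 := hx q3 ((le_max_right _ _).trans (le_max_right _ _))
        ((min_le_right _ _).trans (min_le_right _ _))
      have y := mul_le_mul_of_nonneg_left (add_le_add (add_le_add x1 x2) x3) hC
      simp only [EE, add_zero, hP]
      linarith
    have cE : Continuous (EE k R (fTilde f) u.w 0) :=
      Continuous.uncurry_left (f := EE k R (fTilde f) u.w) 0 (EE_cont hk1 hR hft H.ft_cont u.cont)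
    have iE : Integrable (EE k R (fTilde f) u.w 0) :=
      cE.integrable_of_hasCompactSupport (EE_compact hR 0)
    have h3 : ∫ z, EE k R (fTilde f) u.w 0 z ≤ δ * (∫ z, eta R z ^ (k + 4) * P z) +
        (2 * R) ^ n * (2 * R ^ 2) * (3 * C * R ^ (-q)) := by
      refine (integral_mono iE (((iφ R hR).const_mul δ).add iI) hEpt).trans ?_
      simp only [Pi.add_apply]
      rw [integral_add ((iφ R hR).const_mul δ) iI, integral_const_mul, integral_indicator hBm,
        setIntegral_const, Box_vol n hR, smul_eq_mul]
    set I := ∫ z, eta R z ^ (k + 4) * P z with hI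
    have hI0 : 0 ≤ I := integral_nonneg (fun z => mul_nonneg (pow_nonneg (eta_nonneg R z) _) (hP0 z))
    have e1 : (2 * R) ^ n * (2 * R ^ 2) * (3 * C * R ^ (-q)) =
        (3 * C) * 2 ^ (n + 1) * R ^ (-(q - (n + 2))) := by
      have : R ^ (-(q - ((n:ℝ) + 2))) = R ^ (-q) * (R ^ n * R ^ 2) := by
        rw [← Real.rpow_natCast, ← Real.rpow_natCast, ← Real.rpow_add hR, ← Real.rpow_add hR]
        congr 1; push_cast; ring
      rw [this, mul_pow, pow_succ]; ring
    rw [e1] at h3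
    have h4 : θ * I ≤ C0 * (δ * I + (3 * C) * 2 ^ (n + 1) * R ^ (-(q - (n + 2)))) :=
      (h2.trans h1).trans (mul_le_mul_of_nonneg_left h3 hC0)
    have h5 : C0 * δ ≤ θ / 2 := by
      rw [hδ]
      rw [mul_div_assoc', div_le_div_iff₀ (by positivity) (by norm_num)]
      nlinarith
    have h6 := mul_le_mul_of_nonneg_right h5 hI0
    have h7 : θ / 2 * I ≤ C0 * ((3 * C) * 2 ^ (n + 1) * R ^ (-(q - (n + 2)))) := by linarith
    have h8 := mul_le_mul_of_nonneg_left h7 (by positivity : 0 ≤ 2 / θ)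
    have e2 : 2 / θ * (θ / 2 * I) = I := by field_simp
    rw [e2] at h8
    linarith
  intro z0
  by_contra hne
  have hw0 : 0 < u.w z0 := lt_of_le_of_ne (hu z0) (Ne.symm hne)
  set S := ∑ i, z0.1 i ^ 2 with hS
  have hS0 : 0 ≤ S := Finset.sum_nonneg (fun i _ => sq_nonneg _)
  set R1 := 1 + S + z0.2 ^ 2 with hR1
  have hR11 : 1 ≤ R1 := by have := sq_nonneg z0.2; linarith
  have hR10 : 0 < R1 := by linarith
  have heta : 0 < eta R1 z0 := by
    refine lt_of_lt_of_le ?_ (le_max_right _ _)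
    unfold qf
    rw [← hS]
    have i1 : S / R1 ^ 2 ≤ S / R1 := by
      gcongr; nlinarith
    have i2 : z0.2 ^ 2 / R1 ^ 4 ≤ z0.2 ^ 2 / R1 := by
      gcongr
      exact le_self_pow₀ hR11 (by norm_num)
    have i3 : 1 - S / R1 - z0.2 ^ 2 / R1 = 1 / R1 := by
      field_simp; rw [hR1]; ring
    have : 0 < 1 / R1 := by positivity
    linarith
  have hI1 : 0 < ∫ z, eta R1 z ^ (k + 4) * P z := by
    refine (cφ R1).integral_pos_of_hasCompactSupport_nonneg_nonzero (sφ R1 hR10)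
      (fun z => mul_nonneg (pow_nonneg (eta_nonneg R1 z) _) (hP0 z)) (x := z0) ?_
    have : 0 < P z0 := mul_pos (H.ft_pos hw0) (H.pos _ hw0)
    positivity
  have hle : ∀ R, R1 ≤ R → ∫ z, eta R1 z ^ (k + 4) * P z ≤
      (2 / θ * C0 * (3 * C) * 2 ^ (n + 1)) * R ^ (-(q - (n + 2))) := by
    intro R hR
    refine le_trans ?_ (hbound R (by linarith))
    refine integral_mono (iφ R1 hR10) (iφ R (by linarith)) (fun z => ?_)
    have := hP0 z; have := eta_nonneg R1 z; have := eta_mono hR10 hR z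
    simp only
    gcongr
  have ht : Tendsto (fun R : ℝ => (2 / θ * C0 * (3 * C) * 2 ^ (n + 1)) * R ^ (-(q - (n + 2)))) atTop
      (nhds ((2 / θ * C0 * (3 * C) * 2 ^ (n + 1)) * 0)) :=
    (tendsto_rpow_neg_atTop (by linarith)).const_mul _
  rw [mul_zero] at ht
  have := ge_of_tendsto ht ((eventually_ge_atTop R1).mono hle)
  linarith

end Helpers

/-- parabolic Liouville theorem under the integral conditions on
`f` and `f̃`. -/
theorem stmt_7 (n : ℕ) (hn : 1 ≤ n) (f : ℝ → ℝ)
    (hf_cont : ContinuousOn f (Ici 0)) (hf_pos : ∀ s : ℝ, 0 < s → 0 < f s)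
    (hf_int : IntegrableOn (fun z : ℝ => f z / z) (Ioc (0 : ℝ) 1))
    (hA : n = 1 ∨ ∃ p : ℝ, 1 < p ∧ p < ((n : ℝ) * ((n : ℝ) + 2)) / ((n : ℝ) - 1) ^ 2 ∧
      ∀ s : ℝ, 0 < s → f s ≤ p * fTilde f s)
    (hB : ∃ c : ℝ, 0 < c ∧ ∃ m₁ m₂ : ℝ,
      2 / 3 < m₂ ∧ m₂ < m₁ ∧ m₁ < 2 * ((n : ℝ) + 2) / (3 * (n : ℝ) + 2) ∧
      (∀ s ∈ Ioc (0 : ℝ) 1, c * s ^ m₁ * fTilde f s ^ (2 * m₁ - 1) ≤ f s) ∧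
      (∀ s : ℝ, 1 < s → c * s ^ m₂ * fTilde f s ^ (2 * m₂ - 1) ≤ f s)) :
    ∀ u : (Fin n → ℝ) → ℝ → ℝ,
      (∀ (x : Fin n → ℝ) (t : ℝ), 0 ≤ u x t) →
      IsEntireParabolicSol f u →
      ∀ (x : Fin n → ℝ) (t : ℝ), u x t = 0 := by
  intro u hu hsol x t
  exact final_reg hn ⟨hf_cont, hf_pos, hf_int⟩ hA hB (regOf hsol) (fun z => hu z.1 z.2)
    (fun z => hsol.2.2.2.2.2.2.2 z.1 z.2) (x, t)
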